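/- Let N ≥ 2, p > 1, α ∈ [0,1] and q > p + α·max(1, (p−1)/(N−1)). Then there exist a bounded weight a : ℝ^N → [0,∞) (α-Hölder continuous if α ∈ (0,1), Lipschitz if α = 1) defining Φ(x,t) = t^p + a(x)·t^q, a compact set S ⊂ Ω of Lebesgue measure zero, and a bounded function w : Ω → ℝ, smooth on Ω∖S, with weak gradient g ∈ L¹(Ω;ℝ^N) and ∫_Ω Φ(x,|g(x)|) dx < ∞, such that w cannot be approximated by smooth functions with convergence of the energy: there is no sequence (φ_j) of C^∞ functions on Ω with ∫_Ω Φ(x,|∇φ_j|) dx < ∞ for every j, φ_j → w in L¹(Ω), and ∫_Ω Φ(x, λ|∇φ_j(x) − g(x)|) dx → 0 as j → ∞ for every λ > 0. (This is the 0-form case of the non-density statement H^{d,Φ(·)} ≠ W^{d,Φ(·)} in Theorem A.) -/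

import Mathlib

open MeasureTheory Real Filter
open scoped Topology ENNReal

noncomputable section

/-- `ℝ^N` with the Euclidean structure. -/
abbrev Euc (N : ℕ) := EuclideanSpace ℝ (Fin N)

/-- The open ball of radius `√N` centered at the origin. -/
def Omg (N : ℕ) : Set (Euc N) := Metric.ball 0 (Real.sqrt N)

/-- A smooth function compactly supported in `Ω`. -/
def IsTestFun (N : ℕ) (φ : Euc N → ℝ) : Prop :=
  ContDiff ℝ (⊤ : ℕ∞) φ ∧ HasCompactSupport φ ∧ tsupport φ ⊆ Omg N

/-- `w` is locally integrable on `Ω` and has weak gradient `g ∈ L¹(Ω;ℝ^N)`. -/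
def HasWeakGradOn (N : ℕ) (w : Euc N → ℝ) (g : Euc N → Euc N) : Prop :=
  LocallyIntegrableOn w (Omg N) ∧ IntegrableOn g (Omg N) ∧
  ∀ φ : Euc N → ℝ, IsTestFun N φ → ∀ i : Fin N,
    (∫ x in Omg N, w x * fderiv ℝ φ x (EuclideanSpace.single i 1))
      = - ∫ x in Omg N, g x i * φ x

section

/-- A monotone jump function on `[0,1]` whose range has ratio-`l` self-similar structure. -/
def cantorJump (l x : ℝ) : ℝ := ∑' k : ℕ, l ^ k * (⌊2 ^ k * x⌋ : ℝ)

lemma summable_cantorJump {l : ℝ} (hl : 0 < l) (hl2 : l < 1 / 2) (x : ℝ) :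
    Summable fun k : ℕ => l ^ k * (⌊2 ^ k * x⌋ : ℝ) := by
  have h1 : Summable fun k : ℕ => (2 * l) ^ k * (|x| + 1) :=
    (summable_geometric_of_lt_one (by positivity) (by linarith)).mul_right _
  refine Summable.of_norm_bounded h1 fun k => ?_
  have h2 : |(⌊2 ^ k * x⌋ : ℝ)| ≤ 2 ^ k * (|x| + 1) := by
    have h3 := Int.floor_le ((2 : ℝ) ^ k * x)
    have h4 := (Int.lt_floor_add_one ((2 : ℝ) ^ k * x)).le
    have h5 : (1 : ℝ) ≤ 2 ^ k := one_le_pow₀ (by norm_num)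
    have h6 : |(2 : ℝ) ^ k * x| = 2 ^ k * |x| := by rw [abs_mul, abs_of_pos (by positivity)]
    have h7 := abs_le.1 h6.le
    rw [abs_le]
    constructor <;> nlinarith [h7.1, h7.2]
  rw [norm_mul, norm_pow, Real.norm_of_nonneg hl.le, Real.norm_eq_abs]
  calc l ^ k * |(⌊2 ^ k * x⌋ : ℝ)| ≤ l ^ k * (2 ^ k * (|x| + 1)) := by gcongr
    _ = (2 * l) ^ k * (|x| + 1) := by rw [mul_pow]; ring

lemma cantorJump_mono {l : ℝ} (hl : 0 < l) (hl2 : l < 1 / 2) : Monotone (cantorJump l) := by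
  intro x y hxy
  refine (summable_cantorJump hl hl2 x).tsum_le_tsum (fun k => ?_) (summable_cantorJump hl hl2 y)
  have : ⌊(2 : ℝ) ^ k * x⌋ ≤ ⌊2 ^ k * y⌋ := Int.floor_mono (by gcongr)
  gcongr

lemma cantorJump_sub_ge {l : ℝ} (hl : 0 < l) (hl2 : l < 1 / 2) {x y : ℝ} (k : ℕ)
    (h : x + (1 / 2) ^ k ≤ y) : l ^ k ≤ cantorJump l y - cantorJump l x := by
  have hxy : x ≤ y := le_trans (by simp) h
  unfold cantorJump
  rw [← (summable_cantorJump hl hl2 y).tsum_sub (summable_cantorJump hl hl2 x)]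
  have hnn : ∀ m : ℕ, 0 ≤ l ^ m * (⌊2 ^ m * y⌋ : ℝ) - l ^ m * (⌊2 ^ m * x⌋ : ℝ) := fun m => by
    have : ⌊(2 : ℝ) ^ m * x⌋ ≤ ⌊2 ^ m * y⌋ := Int.floor_mono (by gcongr)
    rw [sub_nonneg]; gcongr
  refine le_trans ?_ (((summable_cantorJump hl hl2 y).sub (summable_cantorJump hl hl2 x)).le_tsum k
    fun m _ => hnn m)
  have h1 : ⌊(2 : ℝ) ^ k * x⌋ + 1 ≤ ⌊2 ^ k * y⌋ := by
    rw [← Int.floor_add_one]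
    apply Int.floor_mono
    have : (2 : ℝ) ^ k * (1 / 2) ^ k = 1 := by rw [← mul_pow]; norm_num
    nlinarith [pow_pos (two_pos : (0 : ℝ) < 2) k]
  have h2 : (⌊(2 : ℝ) ^ k * x⌋ : ℝ) + 1 ≤ ⌊2 ^ k * y⌋ := by exact_mod_cast h1
  nlinarith [pow_pos hl k]

lemma cantorJump_mem {l : ℝ} (hl : 0 < l) (hl2 : l < 1 / 2) {x : ℝ} (hx : x ∈ Set.Ico (0 : ℝ) 1) :
    cantorJump l x ∈ Set.Icc 0 (1 / (1 - 2 * l)) := by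
  constructor
  · refine tsum_nonneg fun k => mul_nonneg (by positivity) ?_
    exact_mod_cast Int.floor_nonneg.2 (mul_nonneg (by positivity) hx.1)
  · have hs := hasSum_geometric_of_lt_one (r := 2 * l) (by positivity) (by linarith)
    rw [one_div, ← hs.tsum_eq]
    refine (summable_cantorJump hl hl2 x).tsum_le_tsum (fun k => ?_) hs.summable
    have := Int.floor_le ((2 : ℝ) ^ k * x)
    have h2 : (2 : ℝ) ^ k * x ≤ 2 ^ k := by
      have := hx.2.le
      exact mul_le_of_le_one_right (by positivity) this
    calc l ^ k * (⌊2 ^ k * x⌋ : ℝ) ≤ l ^ k * 2 ^ k := by gcongr; linarith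
      _ = (2 * l) ^ k := by rw [mul_pow]; ring

lemma abs_cantorJump_sub_le {l : ℝ} (hl : 0 < l) (hl2 : l < 1 / 2) {x y : ℝ} (k : ℕ)
    (h : ⌊(2 : ℝ) ^ k * x⌋ = ⌊2 ^ k * y⌋) :
    |cantorJump l x - cantorJump l y| ≤ 2 / (1 - 2 * l) * l ^ k := by
  have hsub := (summable_cantorJump hl hl2 x).sub (summable_cantorJump hl hl2 y)
  have hs := hasSum_geometric_of_lt_one (r := 2 * l) (by positivity) (by linarith)
  have hdist : |x - y| ≤ (1 / 2) ^ k := by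
    have := Int.abs_sub_lt_one_of_floor_eq_floor h
    rw [← mul_sub, abs_mul, abs_of_pos (by positivity)] at this
    rw [one_div, inv_pow, ← one_div, le_div_iff₀ (by positivity)]
    linarith
  have hlow : ∀ m < k, (⌊(2 : ℝ) ^ m * x⌋ : ℝ) = ⌊2 ^ m * y⌋ := by
    intro m hm
    have key : ∀ z : ℝ, ⌊(2 : ℝ) ^ m * z⌋ = ⌊2 ^ k * z⌋ / (2 ^ (k - m) : ℕ) := by
      intro z
      rw [← Int.floor_div_natCast]
      congr 1
      push_cast
      rw [eq_div_iff (by positivity), mul_right_comm, ← pow_add, Nat.add_sub_cancel' hm.le]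
    rw [key x, key y, h]
  unfold cantorJump
  rw [← (summable_cantorJump hl hl2 x).tsum_sub (summable_cantorJump hl hl2 y),
    ← hsub.sum_add_tsum_nat_add k, Finset.sum_eq_zero, zero_add]
  swap
  · intro m hm
    rw [hlow m (Finset.mem_range.1 hm), sub_self]
  have hb : HasSum (fun i : ℕ => (2 * l ^ k) * (2 * l) ^ i) (2 * l ^ k * (1 - 2 * l)⁻¹) :=
    hs.mul_left _
  have := tsum_of_norm_bounded (f := fun i : ℕ => l ^ (i + k) * (⌊(2 : ℝ) ^ (i + k) * x⌋ : ℝ)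
    - l ^ (i + k) * (⌊(2 : ℝ) ^ (i + k) * y⌋ : ℝ)) hb ?_
  · rw [Real.norm_eq_abs] at this
    refine this.trans (le_of_eq ?_)
    ring
  intro i
  rw [← mul_sub, norm_mul, norm_pow, Real.norm_of_nonneg hl.le, Real.norm_eq_abs]
  have h3 : |(⌊(2 : ℝ) ^ (i + k) * x⌋ : ℝ) - ⌊(2 : ℝ) ^ (i + k) * y⌋| ≤ 2 * 2 ^ i := by
    have a1 := Int.floor_le ((2 : ℝ) ^ (i + k) * x)
    have a2 := (Int.lt_floor_add_one ((2 : ℝ) ^ (i + k) * x)).le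
    have b1 := Int.floor_le ((2 : ℝ) ^ (i + k) * y)
    have b2 := (Int.lt_floor_add_one ((2 : ℝ) ^ (i + k) * y)).le
    have h5 : (1 : ℝ) ≤ 2 ^ i := one_le_pow₀ (by norm_num)
    have h6 : |(2 : ℝ) ^ (i + k) * x - 2 ^ (i + k) * y| ≤ 2 ^ i := by
      rw [← mul_sub, abs_mul, abs_of_pos (by positivity), pow_add]
      calc (2 : ℝ) ^ i * 2 ^ k * |x - y| ≤ 2 ^ i * 2 ^ k * (1 / 2) ^ k := by gcongr
        _ = 2 ^ i := by rw [mul_assoc, ← mul_pow]; norm_num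
    have h7 := abs_le.1 h6
    rw [abs_le]
    constructor <;> linarith [h7.1, h7.2]
  calc l ^ (i + k) * _ ≤ l ^ (i + k) * (2 * 2 ^ i) := by gcongr
    _ = 2 * l ^ k * (2 * l) ^ i := by rw [mul_pow, pow_add]; ring

end

section

/-- A probability measure `ν` on a compact null set `Z ⊆ [0, 1/4]` of codimension `β`: `ν` is
`(1 - β)`-Frostman and all powers `dist(·, Z)^(-κ)`, `0 < κ < β`, are locally integrable. -/
structure IsCantorMeasure (β A : ℝ) (ν : Measure ℝ) (Z : Set ℝ) : Prop where
  prob : IsProbabilityMeasure ν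
  compact : IsCompact Z
  subset : Z ⊆ Set.Icc 0 (1 / 4)
  ae_mem : ∀ᵐ v ∂ν, v ∈ Z
  null : volume Z = 0
  pos : 0 < A
  frostman : ∀ u r : ℝ, 0 < r → ν (Metric.closedBall u r) ≤ ENNReal.ofReal (A * r ^ (1 - β))
  lintegral_lt_top : ∀ κ R : ℝ, 0 < κ → κ < β →
    ∫⁻ t in Set.Icc (-R) R, ENNReal.ofReal (Metric.infDist t Z ^ (-κ)) < ⊤

lemma IsCantorMeasure.nonempty {β A : ℝ} {ν : Measure ℝ} {Z : Set ℝ}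
    (h : IsCantorMeasure β A ν Z) : Z.Nonempty := by
  have := h.prob
  exact h.ae_mem.exists

lemma volume_preimage_cantorJump_le {l c : ℝ} (hl : 0 < l) (hl2 : l < 1 / 2) (hc : 0 < c)
    {D : ℝ} (hD : 0 ≤ D) (hlD : l ^ D = 1 / 2) {u r : ℝ} (hr : 0 < r) :
    volume ({x | c * cantorJump l x ∈ Metric.closedBall u r} ∩ Set.Ico 0 1)
      ≤ ENNReal.ofReal (2 * (3 / c) ^ D * r ^ D) := by
  by_cases hX : 3 * r / c ≤ 1
  · obtain ⟨k, hk1, hk2⟩ := exists_nat_pow_near_of_lt_one (x := 3 * r / c) (by positivity) hX hl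
      (by linarith)
    have hdiff : ∀ x ∈ ({x | c * cantorJump l x ∈ Metric.closedBall u r} ∩ Set.Ico (0 : ℝ) 1),
        ∀ y ∈ ({x | c * cantorJump l x ∈ Metric.closedBall u r} ∩ Set.Ico (0 : ℝ) 1),
        y ≤ x + (1 / 2) ^ k := by
      intro x hx y hy
      by_contra! hcon
      have h1 := cantorJump_sub_ge hl hl2 k hcon.le
      have h2 := abs_le.1 (Real.dist_eq _ _ ▸ Metric.mem_closedBall.1 hx.1)
      have h3 := abs_le.1 (Real.dist_eq _ _ ▸ Metric.mem_closedBall.1 hy.1)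
      rw [div_le_iff₀ hc] at hk2
      nlinarith [h2.1, h2.2, h3.1, h3.2]
    refine (Real.volume_le_diam _).trans ?_
    refine (Metric.ediam_le (d := ENNReal.ofReal ((1 / 2) ^ k)) ?_).trans ?_
    · intro x hx y hy
      rw [edist_dist]
      apply ENNReal.ofReal_le_ofReal
      rw [Real.dist_eq, abs_le]
      constructor <;> linarith [hdiff x hx y hy, hdiff y hy x hx]
    · apply ENNReal.ofReal_le_ofReal
      have h1 : ((1 : ℝ) / 2) ^ k = 2 * (l ^ (k + 1)) ^ D := by
        rw [← Real.rpow_natCast l, ← Real.rpow_mul hl.le, mul_comm (_ : ℝ) D, Real.rpow_mul hl.le,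
          hlD, Real.rpow_natCast, pow_succ]
        ring
      rw [h1, mul_assoc, ← Real.mul_rpow (by positivity) hr.le]
      gcongr
      calc l ^ (k + 1) ≤ 3 * r / c := hk1.le
        _ = 3 / c * r := by ring
  · refine (measure_mono Set.inter_subset_right).trans ?_
    rw [Real.volume_Ico]
    apply ENNReal.ofReal_le_ofReal
    rw [mul_assoc, ← Real.mul_rpow (by positivity) hr.le]
    have : 1 ≤ (3 / c * r) ^ D := Real.one_le_rpow (by
      push Not at hX
      calc 1 ≤ 3 * r / c := hX.le
        _ = 3 / c * r := by ring) hD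
    linarith

lemma volume_infDist_cantorJump_le {l c : ℝ} (hl : 0 < l) (hl2 : l < 1 / 2) (hc : 0 < c)
    (hcl : c * (2 / (1 - 2 * l)) ≤ 1 / 2) (k : ℕ) :
    volume {t : ℝ | Metric.infDist t (closure ((fun x => c * cantorJump l x) '' Set.Ico 0 1))
      ≤ l ^ k} ≤ ENNReal.ofReal (4 * (2 * l) ^ k) := by
  have hsub : {t : ℝ | Metric.infDist t (closure ((fun x => c * cantorJump l x) '' Set.Ico 0 1))
      ≤ l ^ k} ⊆ ⋃ j ∈ Finset.range (2 ^ k),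
        Metric.closedBall (c * cantorJump l (j / 2 ^ k)) (2 * l ^ k) := by
    intro t ht
    rw [Set.mem_ofPred_eq, Metric.infDist_closure] at ht
    have hlk : 0 < l ^ k := pow_pos hl k
    have hne : ((fun x => c * cantorJump l x) '' Set.Ico (0 : ℝ) 1).Nonempty :=
      ⟨_, 0, by simp, rfl⟩
    obtain ⟨_, ⟨x, hx, rfl⟩, hxt⟩ := (Metric.infDist_lt_iff (x := t) hne (r := 3 / 2 * l ^ k)).1
      (by linarith)
    have h0 : 0 ≤ (2 : ℝ) ^ k * x := mul_nonneg (by positivity) hx.1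
    simp only [Set.mem_iUnion, Finset.mem_range]
    refine ⟨⌊(2 : ℝ) ^ k * x⌋₊, ?_, ?_⟩
    · rw [Nat.floor_lt h0]
      push_cast
      exact mul_lt_of_lt_one_right (by positivity) hx.2
    · have hfl : ⌊(2 : ℝ) ^ k * x⌋ = ⌊(2 : ℝ) ^ k * ((⌊(2 : ℝ) ^ k * x⌋₊ : ℝ) / 2 ^ k)⌋ := by
        rw [mul_div_cancel₀ _ (by positivity), Int.floor_natCast, Int.natCast_floor_eq_floor h0]
      have h1 := abs_cantorJump_sub_le hl hl2 k hfl
      rw [Metric.mem_closedBall]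
      refine (dist_triangle _ (c * cantorJump l x) _).trans ?_
      have h2 : dist (c * cantorJump l x) (c * cantorJump l ((⌊(2 : ℝ) ^ k * x⌋₊ : ℝ) / 2 ^ k))
          ≤ 1 / 2 * l ^ k := by
        rw [Real.dist_eq, ← mul_sub, abs_mul, abs_of_pos hc]
        calc c * _ ≤ c * (2 / (1 - 2 * l) * l ^ k) := by gcongr
          _ = c * (2 / (1 - 2 * l)) * l ^ k := by ring
          _ ≤ _ := by gcongr
      dsimp only at hxt
      linarith
  refine (measure_mono hsub).trans ((measure_biUnion_finset_le _ _).trans ?_)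
  simp only [Real.volume_closedBall, Finset.sum_const, Finset.card_range, nsmul_eq_mul]
  rw [← ENNReal.ofReal_natCast, ← ENNReal.ofReal_mul (by positivity)]
  apply ENNReal.ofReal_le_ofReal
  push_cast
  rw [mul_pow]
  apply le_of_eq
  ring

lemma lintegral_infDist_rpow_lt_top {Z : Set ℝ} {l κ R : ℝ} (hl : 0 < l) (hl1 : l < 1)
    (hκ : 0 < κ) (hlκ : 2 * l * l ^ (-κ) < 1)
    (hZ : ∀ k : ℕ, volume {t : ℝ | Metric.infDist t Z ≤ l ^ k} ≤ ENNReal.ofReal (4 * (2 * l) ^ k)) :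
    ∫⁻ t in Set.Icc (-R) R, ENNReal.ofReal (Metric.infDist t Z ^ (-κ)) < ⊤ := by
  set T : ℕ → Set ℝ := fun k => {t : ℝ | Metric.infDist t Z ≤ l ^ k} with hT
  have hTm : ∀ k, MeasurableSet (T k) := fun k =>
    (isClosed_le (Metric.continuous_infDist_pt Z) continuous_const).measurableSet
  set c : ℕ → ℝ := fun k => (l ^ (k + 1)) ^ (-κ) with hc
  have hpt : ∀ t : ℝ, ENNReal.ofReal (Metric.infDist t Z ^ (-κ)) ≤
      1 + ∑' k, (T k).indicator (fun _ => ENNReal.ofReal (c k)) t := by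
    intro t
    rcases (Metric.infDist_nonneg (x := t) (s := Z)).eq_or_lt with h0 | h0
    · rw [← h0, Real.zero_rpow (by linarith)]; simp
    by_cases h1 : Metric.infDist t Z ≤ 1
    · obtain ⟨k, hk1, hk2⟩ := exists_nat_pow_near_of_lt_one h0 h1 hl hl1
      refine le_trans ?_ (le_add_of_nonneg_left zero_le_one)
      refine le_trans ?_ (ENNReal.le_tsum k)
      rw [Set.indicator_of_mem (show t ∈ T k from hk2)]
      apply ENNReal.ofReal_le_ofReal
      exact Real.rpow_le_rpow_of_nonpos (by positivity) hk1.le (by linarith)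
    · refine le_trans ?_ (le_add_of_nonneg_right zero_le)
      rw [← ENNReal.ofReal_one]
      apply ENNReal.ofReal_le_ofReal
      exact Real.rpow_le_one_of_one_le_of_nonpos (by linarith) (by linarith)
  refine (lintegral_mono hpt).trans_lt ?_
  rw [lintegral_add_left measurable_const, lintegral_tsum
    (fun k => (measurable_const.indicator (hTm k)).aemeasurable)]
  refine ENNReal.add_lt_top.2 ⟨by simp, ?_⟩
  have hck : ∀ k, ∫⁻ t in Set.Icc (-R) R, (T k).indicator (fun _ => ENNReal.ofReal (c k)) t
      ≤ ENNReal.ofReal (4 * l ^ (-κ) * (2 * l * l ^ (-κ)) ^ k) := by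
    intro k
    refine (setLIntegral_le_lintegral _ _).trans ?_
    rw [lintegral_indicator_const (hTm k)]
    refine (mul_le_mul_right (hZ k) _).trans ?_
    rw [← ENNReal.ofReal_mul (by positivity)]
    apply ENNReal.ofReal_le_ofReal
    have : c k = l ^ (-κ) * (l ^ (-κ)) ^ k := by
      simp only [hc]
      rw [← Real.rpow_natCast, ← Real.rpow_natCast, ← Real.rpow_mul hl.le, ← Real.rpow_mul hl.le,
        ← Real.rpow_add hl]
      congr 1; push_cast; ring
    rw [this, mul_pow (2 * l)]
    apply le_of_eq; ring
  refine (ENNReal.tsum_le_tsum hck).trans_lt ?_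
  rw [← ENNReal.ofReal_tsum_of_nonneg (fun k => by positivity)]
  · exact ENNReal.ofReal_lt_top
  · exact (summable_geometric_of_lt_one (by positivity) hlκ).mul_left _

lemma exists_isCantorMeasure {β : ℝ} (h0 : 0 < β) (h1 : β < 1) :
    ∃ (A : ℝ) (ν : Measure ℝ) (Z : Set ℝ), IsCantorMeasure β A ν Z := by
  set D := 1 - β with hD
  have hD0 : 0 < D := by linarith
  set l : ℝ := (1 / 2) ^ (1 / D) with hldef
  have hl : 0 < l := by positivity
  have hlD : l ^ D = 1 / 2 := by
    rw [hldef, ← Real.rpow_mul (by norm_num), one_div_mul_cancel hD0.ne', Real.rpow_one]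
  have hl2 : l < 1 / 2 := by
    have : (1 / 2 : ℝ) ^ (1 / D) < (1 / 2) ^ (1 : ℝ) :=
      Real.rpow_lt_rpow_of_exponent_gt (by norm_num) (by norm_num)
        (by rw [lt_div_iff₀ hD0]; linarith)
    rwa [Real.rpow_one] at this
  set c : ℝ := (1 - 2 * l) / 4 with hcdef
  have h2l : 0 < 1 - 2 * l := by linarith
  have hc : 0 < c := by positivity
  have hcl : c * (2 / (1 - 2 * l)) ≤ 1 / 2 := by
    rw [hcdef]; field_simp; norm_num
  set f : ℝ → ℝ := fun x => c * cantorJump l x with hf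
  have hfm : Measurable f := (cantorJump_mono hl hl2).measurable.const_mul c
  set Z := closure (f '' Set.Ico 0 1) with hZ
  have hsub : Z ⊆ Set.Icc 0 (1 / 4) := by
    refine closure_minimal ?_ isClosed_Icc
    rintro _ ⟨x, hx, rfl⟩
    have := cantorJump_mem hl hl2 hx
    refine ⟨mul_nonneg hc.le this.1, ?_⟩
    calc c * cantorJump l x ≤ c * (1 / (1 - 2 * l)) := by gcongr; exact this.2
      _ = 1 / 4 := by rw [hcdef]; field_simp
  have hvol := volume_infDist_cantorJump_le hl hl2 hc hcl
  refine ⟨2 * (3 / c) ^ D, (volume.restrict (Set.Ico 0 1)).map f, Z, ?_, ?_, hsub, ?_, ?_,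
    by positivity, ?_, ?_⟩
  · have : IsProbabilityMeasure (volume.restrict (Set.Ico (0 : ℝ) 1)) := ⟨by simp⟩
    exact Measure.isProbabilityMeasure_map hfm.aemeasurable
  · exact (isCompact_Icc.of_isClosed_subset isClosed_closure hsub)
  · rw [ae_map_iff (p := fun v => v ∈ Z) hfm.aemeasurable isClosed_closure.measurableSet]
    filter_upwards [ae_restrict_mem measurableSet_Ico] with x hx
    exact subset_closure ⟨x, hx, rfl⟩
  · have hlim : Tendsto (fun k : ℕ => ENNReal.ofReal (4 * (2 * l) ^ k)) atTop (𝓝 0) := by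
      have h3 : Tendsto (fun k : ℕ => 4 * (2 * l) ^ k) atTop (𝓝 (4 * 0)) :=
        (tendsto_pow_atTop_nhds_zero_of_lt_one (by positivity) (by linarith)).const_mul 4
      simpa using ENNReal.tendsto_ofReal h3
    refine le_antisymm (ge_of_tendsto' hlim fun k => (measure_mono ?_).trans (hvol k)) zero_le
    intro t ht
    simp only [Set.mem_ofPred_eq]
    rw [Metric.infDist_zero_of_mem ht]
    positivity
  · intro u r hr
    rw [Measure.map_apply hfm Metric.isClosed_closedBall.measurableSet,
      Measure.restrict_apply (hfm Metric.isClosed_closedBall.measurableSet)]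
    exact volume_preimage_cantorJump_le hl hl2 hc hD0.le hlD hr
  · intro κ R hκ hκβ
    refine lintegral_infDist_rpow_lt_top hl (by linarith) hκ ?_ hvol
    have h4 : l * l ^ (-κ) = l ^ (1 - κ) := by
      rw [sub_eq_add_neg, Real.rpow_add hl, Real.rpow_one]
    have h5 : l ^ (1 - κ) < l ^ D :=
      Real.rpow_lt_rpow_of_exponent_gt hl (by linarith) (by linarith)
    rw [mul_assoc, h4]
    linarith

end

section

lemma contDiffOn_integral_mul_param {P G : Type*} [NormedAddCommGroup P] [NormedSpace ℝ P]
    [NormedAddCommGroup G] [NormedSpace ℝ G] [MeasurableSpace G] [BorelSpace G] {μ : Measure G}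
    {n : ℕ∞} {f : G → ℝ} {h : P → G → ℝ} {s : Set P} {k : Set G} (hs : IsOpen s) (hk : IsCompact k)
    (h0 : ∀ p ∈ s, ∀ u ∉ k, h p u = 0) (hf : LocallyIntegrable f μ)
    (hh : ContDiffOn ℝ n ↿h (s ×ˢ Set.univ)) :
    ContDiffOn ℝ n (fun p => ∫ u, f u * h p u ∂μ) s := by
  have hg : ContDiffOn ℝ n ↿(fun p x => h p (-x)) (s ×ˢ Set.univ) := by
    refine hh.comp (g := ↿h) (f := fun q : P × G => (q.1, -q.2)) (by fun_prop) ?_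
    rintro ⟨p, u⟩ ⟨hp, -⟩
    exact ⟨hp, trivial⟩
  have := contDiffOn_convolution_right_with_param_comp (μ := μ) (ContinuousLinearMap.mul ℝ ℝ)
    (v := fun _ : P => (0 : G)) contDiffOn_const hs hk.neg
    (g := fun p x => h p (-x)) (fun p x hp hx => h0 p hp (-x) (by simpa using hx)) hf hg
  simpa [MeasureTheory.convolution] using this

variable {n : ℕ}

/-- The fixed mollification kernel on `ℝ^n`. -/
def mollKernel (n : ℕ) : ContDiffBump (0 : Fin n → ℝ) := ⟨1 / 4, 1 / 2, by norm_num, by norm_num⟩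

/-- The mollification of `δ` at point `y` and scale `r`, as a function of `(r, y)`. -/
def scaledMoll (δ : (Fin n → ℝ) → ℝ) (p : ℝ × (Fin n → ℝ)) : ℝ :=
  ∫ u, δ u * ((p.1 ^ n)⁻¹ * (mollKernel n).normed volume (p.1⁻¹ • (p.2 - u)))

lemma scaledMoll_eq (δ : (Fin n → ℝ) → ℝ) {r : ℝ} (hr : 0 < r) (y : Fin n → ℝ) :
    scaledMoll δ (r, y) = ∫ z, δ (y - r • z) * (mollKernel n).normed volume z := by
  unfold scaledMoll
  have h1 : ∀ u : Fin n → ℝ, δ u * ((r ^ n)⁻¹ * (mollKernel n).normed volume (r⁻¹ • (y - u))) =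
      (r ^ n)⁻¹ * (fun z => δ (y - r • z) * (mollKernel n).normed volume z) (r⁻¹ • (y - u)) := by
    intro u
    simp only [smul_inv_smul₀ hr.ne', sub_sub_cancel]
    ring
  simp_rw [h1]
  rw [integral_const_mul, integral_sub_left_eq_self
    (fun v => (fun z => δ (y - r • z) * (mollKernel n).normed volume z) (r⁻¹ • v)) volume y,
    Measure.integral_comp_inv_smul volume
      (fun z => δ (y - r • z) * (mollKernel n).normed volume z) r, Module.finrank_fin_fun, abs_of_pos (by positivity), smul_eq_mul,
    inv_mul_cancel_left₀ (by positivity)]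

lemma contDiffOn_scaledMoll {δ : (Fin n → ℝ) → ℝ} (hδ : Continuous δ) :
    ContDiffOn ℝ (⊤ : ℕ∞) (scaledMoll δ) {p | 0 < p.1} := by
  intro p₀ hp₀
  have hp₀' : 0 < p₀.1 := hp₀
  set R := ‖p₀‖ + 1
  set s : Set (ℝ × (Fin n → ℝ)) := {p | 0 < p.1} ∩ Metric.ball 0 R with hs
  have hso : IsOpen s := (isOpen_lt continuous_const continuous_fst).inter Metric.isOpen_ball
  have hmem : p₀ ∈ s := ⟨hp₀, by simp [R]⟩
  refine ContDiffAt.contDiffWithinAt (ContDiffOn.contDiffAt ?_ (hso.mem_nhds hmem))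
  refine contDiffOn_integral_mul_param hso (isCompact_closedBall (0 : Fin n → ℝ) (2 * R)) ?_
    hδ.locallyIntegrable
    (h := fun p u => (p.1 ^ n)⁻¹ * (mollKernel n).normed volume (p.1⁻¹ • (p.2 - u))) ?_
  · rintro p ⟨hp, hpR⟩ u hu
    have hp' : 0 < p.1 := hp
    have : (mollKernel n).normed volume (p.1⁻¹ • (p.2 - u)) = 0 := by
      by_contra hne
      have h1 := Function.mem_support.2 hne
      rw [ContDiffBump.support_normed_eq, mem_ball_zero_iff, norm_smul, norm_inv,
        Real.norm_of_nonneg hp'.le, inv_mul_lt_iff₀ hp'] at h1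
      apply hu
      rw [mem_ball_zero_iff] at hpR
      have h2 := norm_fst_le p
      have h3 := norm_snd_le p
      rw [Real.norm_of_nonneg hp'.le] at h2
      have h4 : (mollKernel n).rOut = 1 / 2 := rfl
      rw [h4] at h1
      have h5 : ‖u‖ ≤ ‖p.2‖ + ‖p.2 - u‖ := by
        have := norm_sub_le p.2 (p.2 - u)
        simpa using this
      rw [mem_closedBall_zero_iff]
      linarith
    rw [this, mul_zero]
  · intro q hq
    have hq' : q.1.1 ≠ 0 := (show 0 < q.1.1 from hq.1.1).ne'
    apply ContDiffAt.contDiffWithinAt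
    have hb : ContDiff ℝ (⊤ : ℕ∞) ((mollKernel n).normed volume) := (mollKernel n).contDiff_normed
    have h1 : ContDiffAt ℝ (⊤ : ℕ∞) (fun q : (ℝ × (Fin n → ℝ)) × (Fin n → ℝ) => q.1.1) q := by
      fun_prop
    refine ((h1.pow n).inv (pow_ne_zero n hq')).mul ?_
    exact hb.contDiffAt.comp q ((h1.inv hq').smul (by fun_prop))

lemma integrable_scaledMoll {δ : (Fin n → ℝ) → ℝ} (hδ : Continuous δ) (r : ℝ) (y : Fin n → ℝ) :
    Integrable fun z => δ (y - r • z) * (mollKernel n).normed volume z := by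
  refine Continuous.integrable_of_hasCompactSupport ?_
    ((mollKernel n).hasCompactSupport_normed.mul_left)
  exact (hδ.comp (by fun_prop)).mul (mollKernel n).continuous_normed

lemma norm_le_of_normed_ne_zero {z : Fin n → ℝ} (hz : (mollKernel n).normed volume z ≠ 0) :
    ‖z‖ ≤ 1 / 2 := by
  have h1 := Function.mem_support.2 hz
  rw [ContDiffBump.support_normed_eq, mem_ball_zero_iff] at h1
  exact h1.le

lemma abs_integral_moll_le {g : (Fin n → ℝ) → ℝ} {C : ℝ}
    (hg : ∀ z, ‖z‖ ≤ 1 / 2 → |g z| ≤ C) :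
    |∫ z, g z * (mollKernel n).normed volume z| ≤ C := by
  have h1 : ‖∫ z, g z * (mollKernel n).normed volume z‖
      ≤ ∫ z, C * (mollKernel n).normed volume z := by
    refine norm_integral_le_of_norm_le ((mollKernel n).integrable_normed.const_mul C)
      (Eventually.of_forall fun z => ?_)
    rw [norm_mul, Real.norm_of_nonneg ((mollKernel n).nonneg_normed z), Real.norm_eq_abs]
    by_cases hz : (mollKernel n).normed volume z = 0
    · simp [hz]
    · exact mul_le_mul_of_nonneg_right (hg z (norm_le_of_normed_ne_zero hz))
        ((mollKernel n).nonneg_normed z)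
  rwa [integral_const_mul, (mollKernel n).integral_normed, mul_one] at h1

lemma abs_scaledMoll_sub_le {δ : (Fin n → ℝ) → ℝ} (hδ : LipschitzWith 1 δ)
    {p p' : ℝ × (Fin n → ℝ)} (hp : 0 < p.1) (hp' : 0 < p'.1) :
    |scaledMoll δ p - scaledMoll δ p'| ≤ 2 * ‖p - p'‖ := by
  obtain ⟨r, y⟩ := p
  obtain ⟨r', y'⟩ := p'
  rw [scaledMoll_eq δ hp, scaledMoll_eq δ hp',
    ← integral_sub (integrable_scaledMoll hδ.continuous _ _)
      (integrable_scaledMoll hδ.continuous _ _)]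
  simp_rw [← sub_mul]
  refine abs_integral_moll_le fun z hz => ?_
  have h1 := hδ.dist_le_mul (y - r • z) (y' - r' • z)
  rw [Real.dist_eq, dist_eq_norm] at h1
  have h2 : y - r • z - (y' - r' • z) = (y - y') - (r - r') • z := by rw [sub_smul]; abel
  have h3 := norm_sub_le (y - y') ((r - r') • z)
  rw [norm_smul] at h3
  have h4 := norm_fst_le ((r, y) - (r', y'))
  have h5 := norm_snd_le ((r, y) - (r', y'))
  simp only [Prod.fst_sub, Prod.snd_sub] at h4 h5
  have h6 : ‖r - r'‖ * ‖z‖ ≤ ‖(r, y) - (r', y')‖ * (1 / 2) := by gcongr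
  rw [h2] at h1
  have h7 := norm_nonneg ((r, y) - (r', y'))
  simp only [NNReal.coe_one, one_mul] at h1
  linarith

lemma abs_scaledMoll_sub_self_le {δ : (Fin n → ℝ) → ℝ} (hδ : LipschitzWith 1 δ)
    {r : ℝ} (hr : 0 < r) (y : Fin n → ℝ) : |scaledMoll δ (r, y) - δ y| ≤ r / 2 := by
  have h0 : δ y = ∫ z, δ y * (mollKernel n).normed volume z := by
    rw [integral_const_mul, (mollKernel n).integral_normed, mul_one]
  rw [scaledMoll_eq δ hr, h0, ← integral_sub (integrable_scaledMoll hδ.continuous _ _)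
    ((mollKernel n).integrable_normed.const_mul _)]
  simp_rw [← sub_mul]
  refine abs_integral_moll_le fun z hz => ?_
  have h1 := hδ.dist_le_mul (y - r • z) y
  rw [Real.dist_eq, dist_eq_norm] at h1
  simp only [NNReal.coe_one, one_mul, sub_sub_cancel_left, norm_neg, norm_smul,
    Real.norm_of_nonneg hr.le] at h1
  nlinarith

lemma scaledMoll_nonneg {δ : (Fin n → ℝ) → ℝ} (hδ : ∀ y, 0 ≤ δ y)
    {r : ℝ} (hr : 0 < r) (y : Fin n → ℝ) : 0 ≤ scaledMoll δ (r, y) := by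
  rw [scaledMoll_eq δ hr]
  exact integral_nonneg fun z => mul_nonneg (hδ _) ((mollKernel n).nonneg_normed z)

end

section

variable {n : ℕ}

/-- A smooth cut-off on the line, equal to `1` on `[-1,1]` and to `0` off `(-2,2)`. -/
def lineBump : ContDiffBump (0 : ℝ) := ⟨1, 2, by norm_num, by norm_num⟩

/-- A version of `sign s` smoothed out in the region where `|s|` is comparable to `δ y`. -/
def smoothSign (δ : (Fin n → ℝ) → ℝ) (p : ℝ × (Fin n → ℝ)) : ℝ :=
  Real.sign p.1 * lineBump (scaledMoll δ (|p.1|, p.2) / |p.1|)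

lemma lineBump_nonneg (x : ℝ) : 0 ≤ lineBump x := lineBump.nonneg

lemma lineBump_of_abs_le {x : ℝ} (hx : |x| ≤ 1) : lineBump x = 1 :=
  lineBump.one_of_mem_closedBall (by simpa [lineBump] using hx)

lemma lineBump_of_le {x : ℝ} (hx : 2 ≤ x) : lineBump x = 0 :=
  lineBump.zero_of_le_dist (by simpa [lineBump] using hx.trans (le_abs_self x))

lemma exists_lipschitzWith_lineBump : ∃ K : NNReal, LipschitzWith K lineBump := by
  obtain ⟨K, hK⟩ := ContDiff.lipschitzWith_of_hasCompactSupport lineBump.hasCompactSupport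
    (lineBump.contDiff (n := 1)) one_ne_zero
  exact ⟨K, hK⟩

lemma abs_smoothSign_le (δ : (Fin n → ℝ) → ℝ) (p : ℝ × (Fin n → ℝ)) : |smoothSign δ p| ≤ 1 := by
  unfold smoothSign
  rw [abs_mul]
  have h1 : |Real.sign p.1| ≤ 1 := by
    rcases Real.sign_apply_eq p.1 with h | h | h <;> simp [h]
  have h2 : |lineBump (scaledMoll δ (|p.1|, p.2) / |p.1|)| ≤ 1 := by
    rw [abs_of_nonneg (lineBump_nonneg _)]; exact lineBump.le_one
  exact mul_le_one₀ h1 (abs_nonneg _) h2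

lemma smoothSign_of_le {δ : (Fin n → ℝ) → ℝ} (hδ : LipschitzWith 1 δ) (h0 : ∀ y, 0 ≤ δ y)
    {s : ℝ} {y : Fin n → ℝ} (h : 2 * δ y ≤ |s|) : smoothSign δ (s, y) = Real.sign s := by
  unfold smoothSign
  rcases eq_or_ne s 0 with rfl | hs
  · simp
  have hs' := abs_pos.2 hs
  have h1 := abs_le.1 (abs_scaledMoll_sub_self_le hδ hs' y)
  have h2 := scaledMoll_nonneg h0 hs' y
  rw [lineBump_of_abs_le, mul_one]
  rw [abs_of_nonneg (by positivity), div_le_one hs']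
  linarith [h1.2]

lemma smoothSign_eq_zero {δ : (Fin n → ℝ) → ℝ} (hδ : LipschitzWith 1 δ)
    {s : ℝ} {y : Fin n → ℝ} (h : 3 * |s| ≤ δ y) : smoothSign δ (s, y) = 0 := by
  unfold smoothSign
  rcases eq_or_ne s 0 with rfl | hs
  · simp
  have hs' := abs_pos.2 hs
  have h1 := abs_le.1 (abs_scaledMoll_sub_self_le hδ hs' y)
  rw [lineBump_of_le, mul_zero]
  rw [le_div_iff₀ hs']
  linarith [h1.1]

lemma contDiffAt_smoothSign {δ : (Fin n → ℝ) → ℝ} (hδ : LipschitzWith 1 δ)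
    {p : ℝ × (Fin n → ℝ)} (h : p.1 ≠ 0 ∨ 0 < δ p.2) :
    ContDiffAt ℝ (⊤ : ℕ∞) (smoothSign δ) p := by
  by_cases hp : p.1 = 0
  · have hd : 0 < δ p.2 := by tauto
    have hev : smoothSign δ =ᶠ[𝓝 p] fun _ => (0 : ℝ) := by
      have h1 : Tendsto (fun q : ℝ × (Fin n → ℝ) => 3 * |q.1|) (𝓝 p) (𝓝 (3 * |p.1|)) :=
        (by fun_prop : Continuous fun q : ℝ × (Fin n → ℝ) => 3 * |q.1|).tendsto p
      have h2 : Tendsto (fun q : ℝ × (Fin n → ℝ) => δ q.2) (𝓝 p) (𝓝 (δ p.2)) :=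
        (hδ.continuous.comp continuous_snd).tendsto p
      filter_upwards [h1.eventually_lt h2 (by simpa [hp] using hd)] with q hq
      exact smoothSign_eq_zero hδ hq.le
    exact contDiffAt_const.congr_of_eventuallyEq hev
  · have habs : ContDiffAt ℝ (⊤ : ℕ∞) (fun q : ℝ × (Fin n → ℝ) => |q.1|) p :=
      (contDiffAt_abs hp).comp p contDiffAt_fst
    have hD : ContDiffAt ℝ (⊤ : ℕ∞) (scaledMoll δ) (|p.1|, p.2) :=
      (contDiffOn_scaledMoll hδ.continuous).contDiffAt
        ((isOpen_lt continuous_const continuous_fst).mem_nhds (abs_pos.2 hp))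
    have h1 : ContDiffAt ℝ (⊤ : ℕ∞)
        (fun q : ℝ × (Fin n → ℝ) => lineBump (scaledMoll δ (|q.1|, q.2) / |q.1|)) p := by
      refine (lineBump.contDiff (n := (⊤ : ℕ∞))).contDiffAt.comp p (ContDiffAt.div ?_ habs (by simpa using hp))
      exact ContDiffAt.comp p (g := scaledMoll δ) (f := fun q => (|q.1|, q.2)) hD
        (habs.prodMk contDiffAt_snd)
    have hs : (fun q : ℝ × (Fin n → ℝ) => Real.sign q.1) =ᶠ[𝓝 p] fun _ => Real.sign p.1 := by
      rcases lt_or_gt_of_ne hp with hp | hp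
      · filter_upwards [(isOpen_lt continuous_fst continuous_const).mem_nhds hp] with q hq
        rw [Real.sign_of_neg hp, Real.sign_of_neg hq]
      · filter_upwards [(isOpen_lt continuous_const continuous_fst).mem_nhds hp] with q hq
        rw [Real.sign_of_pos hp, Real.sign_of_pos hq]
    refine ((contDiffAt_const (c := Real.sign p.1)).mul h1).congr_of_eventuallyEq ?_
    filter_upwards [hs] with q hq
    simp only [smoothSign, hq]

lemma sign_eq_of_abs_sub_lt {s s' : ℝ} (h : |s' - s| < |s|) : Real.sign s' = Real.sign s := by
  rcases lt_trichotomy s 0 with hs | hs | hs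
  · rw [abs_of_neg hs, abs_lt] at h
    rw [Real.sign_of_neg hs, Real.sign_of_neg (by linarith)]
  · simp [hs] at h
    linarith [abs_nonneg s']
  · rw [abs_of_pos hs, abs_lt] at h
    rw [Real.sign_of_pos hs, Real.sign_of_pos (by linarith)]

lemma exists_abs_smoothSign_sub_le : ∃ A : ℝ, 0 < A ∧ ∀ {δ : (Fin n → ℝ) → ℝ},
    LipschitzWith 1 δ → (∀ y, 0 ≤ δ y) → ∀ p p' : ℝ × (Fin n → ℝ), 0 < δ p.2 →
      ‖p' - p‖ ≤ δ p.2 / 100 →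
      |smoothSign δ p' - smoothSign δ p| ≤ A / δ p.2 * ‖p' - p‖ := by
  obtain ⟨K, hK⟩ := exists_lipschitzWith_lineBump
  refine ⟨K * 139 + 1, by positivity, ?_⟩
  rintro δ hδ h0 ⟨s, y⟩ ⟨s', y'⟩ hd hp
  simp only at hd hp
  set d := δ y with hdd
  set ρ := ‖(s', y') - (s, y)‖ with hρ
  have hρ0 : 0 ≤ ρ := norm_nonneg _
  have hρ1 : |s' - s| ≤ ρ := norm_fst_le ((s', y') - (s, y))
  have hρ2 : ‖y' - y‖ ≤ ρ := norm_snd_le ((s', y') - (s, y))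
  have hδ1 : |δ y' - d| ≤ ρ := by
    have := hδ.dist_le_mul y' y
    rw [Real.dist_eq, dist_eq_norm] at this
    simp only [NNReal.coe_one, one_mul] at this
    exact this.trans hρ2
  have hss : |(|s'| - |s|)| ≤ ρ := (abs_abs_sub_abs_le _ _).trans hρ1
  have e1 := abs_le.1 hδ1
  have e2 := abs_le.1 hss
  rcases lt_or_ge |s| (d / 10) with hs | hs
  · rw [smoothSign_eq_zero hδ (s := s) (y := y) (by linarith),
      smoothSign_eq_zero hδ (s := s') (y := y') (by linarith [e1.1, e2.2])]
    simp only [sub_self, abs_zero]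
    positivity
  · have hsp : 0 < |s| := by linarith
    have hs'1 : 9 * d / 100 ≤ |s'| := by linarith [e2.1]
    have hs'p : 0 < |s'| := by linarith
    have hsg : Real.sign s' = Real.sign s := sign_eq_of_abs_sub_lt (by linarith)
    unfold smoothSign
    simp only [hsg, ← mul_sub]
    rw [abs_mul]
    have hsg1 : |Real.sign s| ≤ 1 := by
      rcases Real.sign_apply_eq s with h | h | h <;> simp [h]
    set D := scaledMoll δ (|s|, y)
    set D' := scaledMoll δ (|s'|, y')
    have hDD : |D' - D| ≤ 2 * ρ := by
      refine (abs_scaledMoll_sub_le hδ (p := (|s'|, y')) (p' := (|s|, y)) hs'p hsp).trans ?_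
      have : ‖(|s'|, y') - (|s|, y)‖ ≤ ρ := by
        rw [Prod.mk_sub_mk, Prod.norm_mk]
        exact max_le hss hρ2
      linarith
    have hD0 : 0 ≤ D := scaledMoll_nonneg h0 hsp y
    have hD1 : D ≤ 21 / 2 * |s| := by
      have := (abs_le.1 (abs_scaledMoll_sub_self_le hδ hsp y)).2
      linarith
    have hq : |D' / |s'| - (D / |s|)| ≤ 139 * ρ / d := by
      have h1 : D' / |s'| - D / |s| = ((D' - D) - (D / |s|) * (|s'| - |s|)) / |s'| := by
        field_simp
        ring
      have h2 : D / |s| ≤ 21 / 2 := by rw [div_le_iff₀ hsp]; exact hD1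
      rw [h1, abs_div, abs_abs, div_le_div_iff₀ hs'p hd]
      have h3 : |(D' - D) - (D / |s|) * (|s'| - |s|)| ≤ 2 * ρ + 21 / 2 * ρ := by
        refine (abs_sub _ _).trans (add_le_add hDD ?_)
        rw [abs_mul, abs_of_nonneg (by positivity)]
        gcongr
      nlinarith
    have hL := hK.dist_le_mul (D' / |s'|) (D / |s|)
    rw [Real.dist_eq, Real.dist_eq] at hL
    calc |Real.sign s| * |lineBump (D' / |s'|) - lineBump (D / |s|)|
        ≤ 1 * (K * (139 * ρ / d)) := by
          gcongr
          exact hL.trans (by gcongr)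
      _ ≤ (K * 139 + 1) / d * ρ := by
          have : (0 : ℝ) ≤ ρ / d := by positivity
          calc 1 * (K * (139 * ρ / d)) = K * 139 * (ρ / d) := by ring
            _ ≤ (K * 139 + 1) * (ρ / d) := by gcongr; linarith
            _ = _ := by ring

lemma measurable_sign : Measurable Real.sign := by
  unfold Real.sign
  exact Measurable.ite measurableSet_Iio measurable_const
    (Measurable.ite measurableSet_Ioi measurable_const measurable_const)

lemma measurable_smoothSign {δ : (Fin n → ℝ) → ℝ} (hδ : LipschitzWith 1 δ) (h0 : ∀ y, 0 ≤ δ y)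
    (y : Fin n → ℝ) : Measurable fun s => smoothSign δ (s, y) := by
  rcases (h0 y).eq_or_lt with h | h
  · have : (fun s => smoothSign δ (s, y)) = Real.sign := by
      ext s
      exact smoothSign_of_le hδ h0 (by rw [← h]; simp)
    rw [this]
    exact measurable_sign
  · refine Continuous.measurable (continuous_iff_continuousAt.2 fun s => ?_)
    exact (contDiffAt_smoothSign hδ (p := (s, y)) (Or.inr h)).continuousAt.comp
      (f := fun s => (s, y)) (by fun_prop)

end

section

variable {n : ℕ} {β A : ℝ} {ν : Measure ℝ} {Z : Set ℝ} {δ : (Fin n → ℝ) → ℝ}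

/-- The convolution in the first variable of `smoothSign δ` with the measure `ν`. -/
def jumpFun (ν : Measure ℝ) (δ : (Fin n → ℝ) → ℝ) (p : ℝ × (Fin n → ℝ)) : ℝ :=
  ∫ v, smoothSign δ (p.1 - v, p.2) ∂ν

lemma abs_jumpFun_le [IsProbabilityMeasure ν] (p : ℝ × (Fin n → ℝ)) : |jumpFun ν δ p| ≤ 1 := by
  have := norm_integral_le_of_norm_le_const (μ := ν)
    (f := fun v => smoothSign δ (p.1 - v, p.2)) (C := 1)
    (Eventually.of_forall fun v => abs_smoothSign_le δ _)
  simpa [jumpFun] using this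

lemma integrable_smoothSign [IsProbabilityMeasure ν] (hδ : LipschitzWith 1 δ) (h0 : ∀ y, 0 ≤ δ y)
    (p : ℝ × (Fin n → ℝ)) : Integrable (fun v => smoothSign δ (p.1 - v, p.2)) ν := by
  refine (integrable_const (1 : ℝ)).mono' ?_ (Eventually.of_forall fun v => abs_smoothSign_le δ _)
  exact ((measurable_smoothSign hδ h0 p.2).comp
    (measurable_const.sub measurable_id)).aestronglyMeasurable

lemma infDist_le_abs_sub {t v : ℝ} (hv : v ∈ Z) : Metric.infDist t Z ≤ |t - v| := by
  rw [← Real.dist_eq]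
  exact Metric.infDist_le_dist_of_mem hv

lemma jumpFun_eq_integral_sign (hν : IsCantorMeasure β A ν Z) (hδ : LipschitzWith 1 δ)
    (h0 : ∀ y, 0 ≤ δ y) {p : ℝ × (Fin n → ℝ)} (h : 2 * δ p.2 ≤ Metric.infDist p.1 Z) :
    jumpFun ν δ p = ∫ v, Real.sign (p.1 - v) ∂ν := by
  refine integral_congr_ae ?_
  filter_upwards [hν.ae_mem] with v hv
  exact smoothSign_of_le hδ h0 (h.trans (infDist_le_abs_sub hv))

lemma jumpFun_eq_one (hν : IsCantorMeasure β A ν Z) (hδ : LipschitzWith 1 δ)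
    (h0 : ∀ y, 0 ≤ δ y) {p : ℝ × (Fin n → ℝ)} (h : 2 * δ p.2 ≤ Metric.infDist p.1 Z)
    (ht : 1 / 4 < p.1) : jumpFun ν δ p = 1 := by
  have := hν.prob
  rw [jumpFun_eq_integral_sign hν hδ h0 h]
  have : ∀ᵐ v ∂ν, Real.sign (p.1 - v) = 1 := by
    filter_upwards [hν.ae_mem] with v hv
    exact Real.sign_of_pos (by linarith [(hν.subset hv).2])
  rw [integral_congr_ae this]
  simp

lemma jumpFun_eq_neg_one (hν : IsCantorMeasure β A ν Z) (hδ : LipschitzWith 1 δ)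
    (h0 : ∀ y, 0 ≤ δ y) {p : ℝ × (Fin n → ℝ)} (h : 2 * δ p.2 ≤ Metric.infDist p.1 Z)
    (ht : p.1 < 0) : jumpFun ν δ p = -1 := by
  have := hν.prob
  rw [jumpFun_eq_integral_sign hν hδ h0 h]
  have : ∀ᵐ v ∂ν, Real.sign (p.1 - v) = -1 := by
    filter_upwards [hν.ae_mem] with v hv
    exact Real.sign_of_neg (by linarith [(hν.subset hv).1])
  rw [integral_congr_ae this]
  simp

lemma jumpFun_eventuallyEq_const (hν : IsCantorMeasure β A ν Z) (hδ : LipschitzWith 1 δ)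
    (h0 : ∀ y, 0 ≤ δ y) {p : ℝ × (Fin n → ℝ)} (h : 2 * δ p.2 < Metric.infDist p.1 Z) :
    jumpFun ν δ =ᶠ[𝓝 p] fun _ => ∫ v, Real.sign (p.1 - v) ∂ν := by
  have h1 : Tendsto (fun q : ℝ × (Fin n → ℝ) => 2 * δ q.2) (𝓝 p) (𝓝 (2 * δ p.2)) :=
    (continuous_const.mul (hδ.continuous.comp continuous_snd)).tendsto p
  have h2 : Tendsto (fun q : ℝ × (Fin n → ℝ) => Metric.infDist q.1 Z) (𝓝 p)
      (𝓝 (Metric.infDist p.1 Z)) :=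
    ((Metric.continuous_infDist_pt Z).comp continuous_fst).tendsto p
  have h3 : Tendsto (fun q : ℝ × (Fin n → ℝ) => |q.1 - p.1|) (𝓝 p) (𝓝 |p.1 - p.1|) :=
    (by fun_prop : Continuous fun q : ℝ × (Fin n → ℝ) => |q.1 - p.1|).tendsto p
  have h4 : |p.1 - p.1| < Metric.infDist p.1 Z := by
    rw [sub_self, abs_zero]; linarith [h0 p.2]
  filter_upwards [h1.eventually_lt h2 h, h3.eventually_lt_const h4] with q hq1 hq2
  rw [jumpFun_eq_integral_sign hν hδ h0 hq1.le]
  refine integral_congr_ae ?_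
  filter_upwards [hν.ae_mem] with v hv
  refine sign_eq_of_abs_sub_lt ?_
  rw [sub_sub_sub_cancel_right]
  exact hq2.trans_le (infDist_le_abs_sub hv)

lemma contDiffAt_jumpFun (hν : IsCantorMeasure β A ν Z) (hδ : LipschitzWith 1 δ)
    (h0 : ∀ y, 0 ≤ δ y) {p : ℝ × (Fin n → ℝ)} (h : p.1 ∉ Z ∨ 0 < δ p.2) :
    ContDiffAt ℝ (⊤ : ℕ∞) (jumpFun ν δ) p := by
  have := hν.prob
  by_cases hd : 0 < δ p.2
  · have hs : IsOpen {q : ℝ × (Fin n → ℝ) | 0 < δ q.2} :=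
      isOpen_lt continuous_const (hδ.continuous.comp continuous_snd)
    have h1 : ContDiffOn ℝ (⊤ : ℕ∞) (fun q : ℝ × (Fin n → ℝ) =>
        ∫ v, (1 : ℝ) * (smoothSign δ (q.1 - v, q.2) * lineBump v) ∂ν) {q | 0 < δ q.2} := by
      refine contDiffOn_integral_mul_param hs (isCompact_closedBall (0 : ℝ) 2) ?_
        (integrable_const (μ := ν) (1 : ℝ)).locallyIntegrable
        (h := fun q v => smoothSign δ (q.1 - v, q.2) * lineBump v) ?_
      · intro q _ v hv
        rw [lineBump.zero_of_le_dist, mul_zero]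
        simp only [Metric.mem_closedBall, not_le] at hv
        exact hv.le
      · rintro ⟨q, v⟩ ⟨hq, -⟩
        refine ContDiffAt.contDiffWithinAt (ContDiffAt.mul ?_ ?_)
        · exact ContDiffAt.comp (g := smoothSign δ)
            (f := fun r : (ℝ × (Fin n → ℝ)) × ℝ => (r.1.1 - r.2, r.1.2)) (q, v)
            (contDiffAt_smoothSign hδ (Or.inr hq)) (by fun_prop)
        · exact (lineBump.contDiff (n := (⊤ : ℕ∞))).contDiffAt.comp (q, v) contDiffAt_snd
    have h2 : jumpFun ν δ = fun q : ℝ × (Fin n → ℝ) =>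
        ∫ v, (1 : ℝ) * (smoothSign δ (q.1 - v, q.2) * lineBump v) ∂ν := by
      ext q
      refine integral_congr_ae ?_
      filter_upwards [hν.ae_mem] with v hv
      have := hν.subset hv
      rw [lineBump_of_abs_le, mul_one, one_mul]
      rw [abs_le]
      constructor <;> linarith [this.1, this.2]
    rw [h2]
    exact h1.contDiffAt (hs.mem_nhds hd)
  · have hz : δ p.2 = 0 := le_antisymm (not_lt.1 hd) (h0 _)
    have hZ : p.1 ∉ Z := by tauto
    have hpos : 2 * δ p.2 < Metric.infDist p.1 Z := by
      rw [hz, mul_zero]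
      exact (hν.compact.isClosed.notMem_iff_infDist_pos hν.nonempty).1 hZ
    exact contDiffAt_const.congr_of_eventuallyEq (jumpFun_eventuallyEq_const hν hδ h0 hpos)

lemma exists_norm_fderiv_jumpFun_le (hν : IsCantorMeasure β A ν Z) : ∃ C : ℝ, 0 < C ∧
    ∀ {δ : (Fin n → ℝ) → ℝ}, LipschitzWith 1 δ → (∀ y, 0 ≤ δ y) →
      ∀ p : ℝ × (Fin n → ℝ), 0 < δ p.2 →
        ‖fderiv ℝ (jumpFun ν δ) p‖ ≤ C * δ p.2 ^ (-β) := by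
  have := hν.prob
  obtain ⟨B, hB, hBle⟩ := exists_abs_smoothSign_sub_le (n := n)
  have hA := hν.pos
  refine ⟨B * A * 3 ^ (1 - β), by positivity, ?_⟩
  intro δ hδ h0 p hd
  set d := δ p.2 with hdd
  refine norm_fderiv_le_of_lip' ℝ (by positivity) ?_
  filter_upwards [Metric.ball_mem_nhds p (show 0 < d / 100 by positivity)] with p' hp'
  rw [Metric.mem_ball, dist_eq_norm] at hp'
  have hδ1 : |δ p'.2 - d| ≤ ‖p' - p‖ := by
    have := hδ.dist_le_mul p'.2 p.2
    rw [Real.dist_eq, dist_eq_norm] at this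
    simp only [NNReal.coe_one, one_mul] at this
    exact this.trans (norm_snd_le (p' - p))
  have ht : |p'.1 - p.1| ≤ ‖p' - p‖ := norm_fst_le (p' - p)
  have hpt : ∀ v, ‖smoothSign δ (p'.1 - v, p'.2) - smoothSign δ (p.1 - v, p.2)‖ ≤
      (Metric.closedBall p.1 (3 * d)).indicator (fun _ => B / d * ‖p' - p‖) v := by
    intro v
    by_cases hv : v ∈ Metric.closedBall p.1 (3 * d)
    · rw [Set.indicator_of_mem hv]
      have hn : ‖(p'.1 - v, p'.2) - (p.1 - v, p.2)‖ = ‖p' - p‖ := by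
        simp [Prod.norm_def]
      have := hBle hδ h0 (p.1 - v, p.2) (p'.1 - v, p'.2) hd (by rw [hn]; exact hp'.le)
      rwa [hn] at this
    · rw [Set.indicator_of_notMem hv]
      rw [Metric.mem_closedBall, Real.dist_eq, not_le, abs_sub_comm] at hv
      have h1 : |p.1 - v| ≤ |p'.1 - v| + |p'.1 - p.1| := by
        have := abs_sub_le p.1 p'.1 v
        rw [abs_sub_comm p.1 p'.1] at this
        linarith
      have h2 := (abs_le.1 hδ1).2
      rw [smoothSign_of_le hδ h0 (show 2 * δ p.2 ≤ |p.1 - v| by linarith),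
        smoothSign_of_le hδ h0 (show 2 * δ p'.2 ≤ |p'.1 - v| by linarith),
        sign_eq_of_abs_sub_lt (s := p.1 - v) (s' := p'.1 - v)
          (by rw [sub_sub_sub_cancel_right]; linarith)]
      simp
  unfold jumpFun
  rw [← integral_sub (integrable_smoothSign hδ h0 p') (integrable_smoothSign hδ h0 p)]
  refine (norm_integral_le_of_norm_le ((integrable_const _).indicator
    Metric.isClosed_closedBall.measurableSet) (Eventually.of_forall hpt)).trans ?_
  rw [integral_indicator_const _ Metric.isClosed_closedBall.measurableSet, smul_eq_mul]
  have hF : ν.real (Metric.closedBall p.1 (3 * d)) ≤ A * (3 * d) ^ (1 - β) :=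
    ENNReal.toReal_le_of_le_ofReal (by positivity) (hν.frostman p.1 (3 * d) (by positivity))
  calc ν.real (Metric.closedBall p.1 (3 * d)) * (B / d * ‖p' - p‖)
      ≤ A * (3 * d) ^ (1 - β) * (B / d * ‖p' - p‖) := by gcongr
    _ = B * A * 3 ^ (1 - β) * d ^ (-β) * ‖p' - p‖ := by
      rw [Real.mul_rpow (by norm_num) hd.le, sub_eq_add_neg, Real.rpow_add hd, Real.rpow_one]
      field_simp

end

section

variable {n : ℕ}

/-- Splitting off the `i`-th coordinate of `ℝ^(n+1)`. -/
def splitCLE (i : Fin (n + 1)) : Euc (n + 1) ≃L[ℝ] ℝ × (Fin n → ℝ) :=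
  LinearEquiv.toContinuousLinearEquiv
    { toFun := fun x => (x i, fun j => x (i.succAbove j))
      invFun := fun p => WithLp.toLp 2 (i.insertNth p.1 p.2)
      map_add' := fun _ _ => rfl
      map_smul' := fun _ _ => rfl
      left_inv := fun x => by
        ext j
        exact congrFun (Fin.insertNth_self_removeNth i (fun j => x j)) j
      right_inv := fun p => by simp }

@[simp] lemma splitCLE_apply (i : Fin (n + 1)) (x : Euc (n + 1)) :
    splitCLE i x = (x i, fun j => x (i.succAbove j)) := rfl

lemma splitCLE_symm_apply (i : Fin (n + 1)) (p : ℝ × (Fin n → ℝ)) :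
    (splitCLE i).symm p = WithLp.toLp 2 (i.insertNth p.1 p.2) := rfl

@[simp] lemma splitCLE_symm_same (i : Fin (n + 1)) (p : ℝ × (Fin n → ℝ)) :
    (splitCLE i).symm p i = p.1 := by
  simp [splitCLE_symm_apply]

@[simp] lemma splitCLE_symm_succAbove (i : Fin (n + 1)) (p : ℝ × (Fin n → ℝ)) (j : Fin n) :
    (splitCLE i).symm p (i.succAbove j) = p.2 j := by
  simp [splitCLE_symm_apply]

lemma norm_splitCLE_le (i : Fin (n + 1)) (x : Euc (n + 1)) : ‖splitCLE i x‖ ≤ ‖x‖ := by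
  rw [splitCLE_apply, Prod.norm_def]
  exact max_le (PiLp.norm_apply_le x i)
    ((pi_norm_le_iff_of_nonneg (norm_nonneg _)).2 fun j => PiLp.norm_apply_le x _)

lemma measurePreserving_splitCLE (i : Fin (n + 1)) :
    MeasurePreserving (splitCLE i : Euc (n + 1) → ℝ × (Fin n → ℝ)) :=
  (volume_preserving_piFinSuccAbove (fun _ : Fin (n + 1) => ℝ) i).comp
    (PiLp.volume_preserving_ofLp (Fin (n + 1)))

lemma measurePreserving_splitCLE_symm (i : Fin (n + 1)) :
    MeasurePreserving ((splitCLE i).symm : ℝ × (Fin n → ℝ) → Euc (n + 1)) :=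
  MeasurePreserving.symm (splitCLE i).toHomeomorph.toMeasurableEquiv (measurePreserving_splitCLE i)

lemma measurableEmbedding_splitCLE (i : Fin (n + 1)) :
    MeasurableEmbedding (splitCLE i : Euc (n + 1) → ℝ × (Fin n → ℝ)) :=
  (splitCLE i).toHomeomorph.measurableEmbedding

lemma measurableEmbedding_splitCLE_symm (i : Fin (n + 1)) :
    MeasurableEmbedding ((splitCLE i).symm : ℝ × (Fin n → ℝ) → Euc (n + 1)) :=
  (splitCLE i).symm.toHomeomorph.measurableEmbedding

lemma mem_Omg_of_abs_lt {x : Euc (n + 1)} (h : ∀ i, |x i| < 1) : x ∈ Omg (n + 1) := by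
  rw [Omg, mem_ball_zero_iff, EuclideanSpace.norm_eq]
  apply Real.sqrt_lt_sqrt (by positivity)
  calc ∑ i, ‖x i‖ ^ 2 < ∑ _i : Fin (n + 1), (1 : ℝ) := by
        refine Finset.sum_lt_sum_of_nonempty Finset.univ_nonempty fun i _ => ?_
        rw [Real.norm_eq_abs]
        exact pow_lt_one₀ (abs_nonneg _) (h i) two_ne_zero
    _ = _ := by simp

lemma splitCLE_symm_mem_Omg (i : Fin (n + 1)) {p : ℝ × (Fin n → ℝ)} (hp : ‖p‖ < 1) :
    (splitCLE i).symm p ∈ Omg (n + 1) := by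
  refine mem_Omg_of_abs_lt fun j => ?_
  have h1 := (norm_fst_le p).trans_lt hp
  refine Fin.succAboveCases i ?_ (fun k => ?_) j
  · simpa using h1
  · rw [splitCLE_symm_succAbove]
    exact ((norm_le_pi_norm p.2 k).trans (norm_snd_le p)).trans_lt hp

lemma volume_apply_mem_eq_zero (i : Fin (n + 1)) {Z : Set ℝ} (hZ : volume Z = 0) :
    volume {x : Euc (n + 1) | x i ∈ Z} = 0 := by
  have h1 : {x : Euc (n + 1) | x i ∈ Z} = splitCLE i ⁻¹' (Z ×ˢ Set.univ) := by
    ext x; simp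
  rw [h1, (measurePreserving_splitCLE i).measure_preimage_emb (measurableEmbedding_splitCLE i),
    Measure.volume_eq_prod, Measure.prod_prod, hZ, zero_mul]

/-- The sup-norm distance of `y` to the `n`-fold product of `Z`. -/
def prodDist (n : ℕ) (Z : Set ℝ) (y : Fin n → ℝ) : ℝ := ‖fun j => Metric.infDist (y j) Z‖

lemma prodDist_nonneg (Z : Set ℝ) (y : Fin n → ℝ) : 0 ≤ prodDist n Z y := norm_nonneg _

lemma abs_infDist_sub_le (Z : Set ℝ) (s t : ℝ) :
    |Metric.infDist s Z - Metric.infDist t Z| ≤ |s - t| := by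
  have := (Metric.lipschitz_infDist_pt Z).dist_le_mul s t
  simpa [Real.dist_eq] using this

lemma lipschitzWith_prodDist (Z : Set ℝ) : LipschitzWith 1 (prodDist n Z) := by
  refine LipschitzWith.of_dist_le_mul fun x y => ?_
  rw [NNReal.coe_one, one_mul, Real.dist_eq]
  refine (abs_norm_sub_norm_le _ _).trans ?_
  refine (pi_norm_le_iff_of_nonneg dist_nonneg).2 fun j => ?_
  exact (abs_infDist_sub_le Z _ _).trans ((Real.dist_eq _ _).symm.le.trans (dist_le_pi_dist x y j))

lemma infDist_le_prodDist (Z : Set ℝ) (y : Fin n → ℝ) (j : Fin n) :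
    Metric.infDist (y j) Z ≤ prodDist n Z y :=
  (le_abs_self _).trans (norm_le_pi_norm (fun j => Metric.infDist (y j) Z) j)

lemma prodDist_pos {Z : Set ℝ} (hZ : IsClosed Z) (hne : Z.Nonempty) {y : Fin n → ℝ} {j : Fin n}
    (h : y j ∉ Z) : 0 < prodDist n Z y :=
  ((hZ.notMem_iff_infDist_pos hne).1 h).trans_le (infDist_le_prodDist Z y j)

lemma prodDist_le_of_mem {Z : Set ℝ} {y z : Fin n → ℝ} (hz : ∀ j, z j ∈ Z) :
    prodDist n Z y ≤ ‖y - z‖ := by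
  refine (pi_norm_le_iff_of_nonneg (norm_nonneg _)).2 fun j => ?_
  rw [Real.norm_of_nonneg Metric.infDist_nonneg]
  exact (infDist_le_abs_sub (hz j)).trans (norm_le_pi_norm (y - z) j)

lemma abs_rpow_sub_rpow_le {a b α : ℝ} (ha : 0 ≤ a) (hb : 0 ≤ b) (h0 : 0 ≤ α) (h1 : α ≤ 1) :
    |a ^ α - b ^ α| ≤ |a - b| ^ α := by
  wlog h : b ≤ a generalizing a b
  · rw [abs_sub_comm, abs_sub_comm a b]
    exact this hb ha (le_of_not_ge h)
  rw [abs_of_nonneg (sub_nonneg.2 (Real.rpow_le_rpow hb h h0)), abs_of_nonneg (sub_nonneg.2 h)]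
  have := Real.rpow_add_le_add_rpow (sub_nonneg.2 h) hb h0 h1
  rw [sub_add_cancel] at this
  linarith

/-- The weight `(min 1 h)^α` on `{h > 0}`, extended by zero. -/
def cutPow (α h : ℝ) : ℝ := if 0 < h then (min 1 h) ^ α else 0

lemma cutPow_nonneg (α h : ℝ) : 0 ≤ cutPow α h := by
  unfold cutPow
  split_ifs with hh
  · exact Real.rpow_nonneg (le_min zero_le_one hh.le) _
  · exact le_rfl

lemma cutPow_le_one {α : ℝ} (hα : 0 ≤ α) (h : ℝ) : cutPow α h ≤ 1 := by
  unfold cutPow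
  split_ifs with hh
  · exact Real.rpow_le_one (le_min zero_le_one hh.le) (min_le_left _ _) hα
  · exact zero_le_one

lemma cutPow_eq {α : ℝ} (hα : 0 < α) (h : ℝ) : cutPow α h = (max 0 (min 1 h)) ^ α := by
  unfold cutPow
  split_ifs with hh
  · rw [max_eq_right (le_min zero_le_one hh.le)]
  · rw [max_eq_left ((min_le_right _ _).trans (not_lt.1 hh)), Real.zero_rpow hα.ne']

lemma abs_cutPow_sub_le {α : ℝ} (hα : 0 < α) (hα1 : α ≤ 1) (h h' : ℝ) :
    |cutPow α h - cutPow α h'| ≤ |h - h'| ^ α := by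
  rw [cutPow_eq hα, cutPow_eq hα]
  refine (abs_rpow_sub_rpow_le (le_max_left _ _) (le_max_left _ _) hα.le hα1).trans ?_
  refine Real.rpow_le_rpow (abs_nonneg _) ?_ hα.le
  refine (abs_max_sub_max_le_max _ _ _ _).trans ?_
  rw [sub_self, abs_zero, max_eq_right (abs_nonneg _)]
  refine (abs_min_sub_min_le_max _ _ _ _).trans ?_
  rw [sub_self, abs_zero, max_eq_right (abs_nonneg _)]

end

section

variable {n : ℕ}

lemma integral_eq_zero_of_hasDerivAt_lines {F F' : Euc (n + 1) → ℝ} (i : Fin (n + 1))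
    (hF : Integrable F) (hF' : Integrable F')
    (hd : ∀ᵐ y : Fin n → ℝ, ∀ s : ℝ, HasDerivAt (fun r => F ((splitCLE i).symm (r, y)))
      (F' ((splitCLE i).symm (s, y))) s) : ∫ x, F' x = 0 := by
  have e := measurePreserving_splitCLE_symm i
  have he := measurableEmbedding_splitCLE_symm i
  rw [← e.integral_comp he F']
  have h1 := (e.integrable_comp_emb he).2 hF
  have h2 := (e.integrable_comp_emb he).2 hF'
  rw [Measure.volume_eq_prod] at h1 h2 ⊢
  change ∫ p, (F' ∘ (splitCLE i).symm) p ∂_ = 0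
  rw [integral_prod_symm _ h2]
  refine integral_eq_zero_of_ae ?_
  filter_upwards [hd, h1.prod_left_ae, h2.prod_left_ae] with y hy hy1 hy2
  exact integral_eq_zero_of_hasDerivAt_of_integrable hy hy2 hy1

lemma splitCLE_symm_add_single (i : Fin (n + 1)) (s r : ℝ) (y : Fin n → ℝ) :
    (splitCLE i).symm (s + r, y) = (splitCLE i).symm (s, y) + r • EuclideanSpace.single i 1 := by
  apply (splitCLE i).injective
  rw [map_add, ContinuousLinearEquiv.apply_symm_apply, ContinuousLinearEquiv.apply_symm_apply,
    map_smul, splitCLE_apply]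
  ext j <;> simp [Fin.succAbove_ne]

lemma hasDerivAt_splitCLE_symm (i : Fin (n + 1)) (s : ℝ) (y : Fin n → ℝ) :
    HasDerivAt (fun r => (splitCLE i).symm (r, y)) (EuclideanSpace.single i 1) s := by
  have h : (fun r => (splitCLE i).symm (r, y)) =
      fun r : ℝ => (splitCLE i).symm (0, y) + r • EuclideanSpace.single i (1 : ℝ) := by
    ext1 r
    rw [← splitCLE_symm_add_single, zero_add]
  rw [h]
  simpa using ((hasDerivAt_id s).smul_const (EuclideanSpace.single i (1 : ℝ))).const_add
    ((splitCLE i).symm (0, y))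

lemma gradient_apply {N : ℕ} (w : Euc N → ℝ) (x : Euc N) (i : Fin N) :
    gradient w x i = fderiv ℝ w x (EuclideanSpace.single i 1) := by
  have h : inner ℝ (gradient w x) (EuclideanSpace.single i (1 : ℝ)) =
      fderiv ℝ w x (EuclideanSpace.single i 1) := by
    rw [gradient, InnerProductSpace.toDual_symm_apply]
  rw [← h, EuclideanSpace.inner_single_right]
  simp

lemma norm_gradient {N : ℕ} (w : Euc N → ℝ) (x : Euc N) :
    ‖gradient w x‖ = ‖fderiv ℝ w x‖ := by
  rw [gradient, LinearIsometryEquiv.norm_map]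

lemma measurable_gradient {N : ℕ} (w : Euc N → ℝ) : Measurable (gradient w) := by
  unfold gradient
  exact (LinearIsometryEquiv.continuous _).measurable.comp (measurable_fderiv ℝ w)

lemma aestronglyMeasurable_of_differentiableAt {N : ℕ} {w : Euc N → ℝ} {S : Set (Euc N)}
    (hS : IsClosed S) (hS0 : volume S = 0) (hw : ∀ x ∉ S, DifferentiableAt ℝ w x) :
    AEStronglyMeasurable w := by
  have h1 : ContinuousOn w Sᶜ := fun x hx => (hw x hx).continuousAt.continuousWithinAt
  have h2 := h1.aestronglyMeasurable (μ := volume) hS.isOpen_compl.measurableSet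
  rwa [Measure.restrict_eq_self_of_ae_mem (show ∀ᵐ x : Euc N, x ∈ Sᶜ from ?_)] at h2
  exact measure_eq_zero_iff_ae_notMem.1 hS0

lemma hasWeakGradOn_gradient {w : Euc (n + 1) → ℝ} {S : Set (Euc (n + 1))} {M : ℝ}
    (hS : IsClosed S) (hS0 : volume S = 0)
    (hline : ∀ i : Fin (n + 1), ∃ j : Fin n, ∃ Z : Set ℝ, volume Z = 0 ∧
      ∀ x ∈ S, x (i.succAbove j) ∈ Z)
    (hw : ∀ x ∉ S, DifferentiableAt ℝ w x) (hM : ∀ x, |w x| ≤ M)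
    (hg : IntegrableOn (gradient w) (Omg (n + 1))) :
    HasWeakGradOn (n + 1) w (gradient w) := by
  have hwm := aestronglyMeasurable_of_differentiableAt hS hS0 hw
  have hΩ : MeasurableSet (Omg (n + 1)) := Metric.isOpen_ball.measurableSet
  refine ⟨?_, hg, ?_⟩
  · refine LocallyIntegrable.locallyIntegrableOn ?_ _
    refine (locallyIntegrable_const M).mono hwm (Eventually.of_forall fun x => ?_)
    exact (hM x).trans (le_abs_self M)
  rintro φ ⟨hφ, hφc, hφΩ⟩ i
  set e : Euc (n + 1) := EuclideanSpace.single i 1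
  have hφd : Differentiable ℝ φ := hφ.differentiable (by simp)
  have hdc : Continuous fun x => fderiv ℝ φ x e :=
    (hφ.continuous_fderiv (by simp)).clm_apply continuous_const
  have hdcs : HasCompactSupport fun x => fderiv ℝ φ x e := hφc.fderiv_apply ℝ e
  have hz1 : ∀ x ∉ Omg (n + 1), φ x = 0 := fun x hx =>
    image_eq_zero_of_notMem_tsupport fun h => hx (hφΩ h)
  have hz2 : ∀ x ∉ Omg (n + 1), fderiv ℝ φ x e = 0 := fun x hx => by
    have : fderiv ℝ φ x = 0 := image_eq_zero_of_notMem_tsupport fun h =>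
      hx (hφΩ (tsupport_fderiv_subset ℝ h))
    rw [this]; rfl
  obtain ⟨B, hB⟩ := hφc.exists_bound_of_continuous hφ.continuous
  have i1 : Integrable fun x => w x * fderiv ℝ φ x e :=
    (hdc.integrable_of_hasCompactSupport hdcs).bdd_mul hwm
      (Eventually.of_forall fun x => hM x)
  have i2 : Integrable fun x => gradient w x i * φ x := by
    have h1 : IntegrableOn (fun x => gradient w x i) (Omg (n + 1)) :=
      (EuclideanSpace.proj (𝕜 := ℝ) i).integrable_comp hg
    have h2 : IntegrableOn (fun x => gradient w x i * φ x) (Omg (n + 1)) :=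
      h1.mul_bdd hφ.continuous.aestronglyMeasurable (Eventually.of_forall hB)
    refine (integrableOn_iff_integrable_of_support_subset ?_).1 h2
    intro x hx
    by_contra hxΩ
    exact hx (by simp [hz1 x hxΩ])
  have i0 : Integrable fun x => w x * φ x :=
    (hφ.continuous.integrable_of_hasCompactSupport hφc).bdd_mul hwm
      (Eventually.of_forall fun x => hM x)
  rw [setIntegral_eq_integral_of_forall_compl_eq_zero (fun x hx => by rw [hz2 x hx, mul_zero]),
    setIntegral_eq_integral_of_forall_compl_eq_zero (fun x hx => by rw [hz1 x hx, mul_zero]),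
    eq_neg_iff_add_eq_zero, ← integral_add i1 i2]
  obtain ⟨j, Z, hZ, hSZ⟩ := hline i
  refine integral_eq_zero_of_hasDerivAt_lines i i0 (i1.add i2) ?_
  have hae : ∀ᵐ y : Fin n → ℝ, y j ∉ Z :=
    (Measure.quasiMeasurePreserving_eval (fun _ : Fin n => (volume : Measure ℝ)) j).ae
      (measure_eq_zero_iff_ae_notMem.1 hZ)
  filter_upwards [hae] with y hy s
  have hx : (splitCLE i).symm (s, y) ∉ S := fun h => hy (by simpa using hSZ _ h)
  have d1 := (hw _ hx).hasFDerivAt.comp_hasDerivAt s (hasDerivAt_splitCLE_symm i s y)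
  have d2 := (hφd ((splitCLE i).symm (s, y))).hasFDerivAt.comp_hasDerivAt s
    (hasDerivAt_splitCLE_symm i s y)
  refine (d1.mul d2).congr_deriv ?_
  simp only [gradient_apply, Function.comp, e]
  ring

end

section

variable {n : ℕ} {β₀ A₀ β₁ A₁ : ℝ} {ν₀ ν₁ : Measure ℝ} {Z₀ Z₁ : Set ℝ}

/-- The function which jumps across `Z₀` only near the product of copies of `Z₁`. -/
def jumpEuc (n : ℕ) (ν₀ : Measure ℝ) (Z₁ : Set ℝ) (x : Euc (n + 1)) : ℝ :=
  jumpFun ν₀ (prodDist n Z₁) (splitCLE 0 x)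

/-- The product set `Z₀ × Z₁ × ⋯ × Z₁`. -/
def prodSet (n : ℕ) (Z₀ Z₁ : Set ℝ) : Set (Euc (n + 1)) :=
  {x | x 0 ∈ Z₀ ∧ ∀ j : Fin n, x j.succ ∈ Z₁}

lemma isCompact_prodSet (h₀ : IsCompact Z₀) (h₁ : IsCompact Z₁) :
    IsCompact (prodSet n Z₀ Z₁) := by
  have h : prodSet n Z₀ Z₁ = (splitCLE 0).toHomeomorph ⁻¹'
      (Z₀ ×ˢ (Set.univ.pi fun _ : Fin n => Z₁)) := by
    ext x
    simp [prodSet, Set.mem_ofPred_eq]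
  rw [h, Homeomorph.isCompact_preimage]
  exact h₀.prod (isCompact_univ_pi fun _ => h₁)

lemma prodSet_subset_Omg (h₀ : Z₀ ⊆ Set.Icc 0 (1 / 4)) (h₁ : Z₁ ⊆ Set.Icc 0 (1 / 4)) :
    prodSet n Z₀ Z₁ ⊆ Omg (n + 1) := by
  rintro x ⟨hx0, hx1⟩
  refine mem_Omg_of_abs_lt fun i => ?_
  have : x i ∈ Set.Icc (0 : ℝ) (1 / 4) := by
    refine Fin.cases (h₀ hx0) (fun j => h₁ (hx1 j)) i
  rw [abs_lt]
  constructor <;> linarith [this.1, this.2]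

lemma volume_prodSet (h₀ : volume Z₀ = 0) : volume (prodSet n Z₀ Z₁) = 0 :=
  measure_mono_null (fun _ hx => hx.1) (volume_apply_mem_eq_zero 0 h₀)

lemma contDiffAt_jumpEuc (h₀ : IsCantorMeasure β₀ A₀ ν₀ Z₀) (h₁ : IsCantorMeasure β₁ A₁ ν₁ Z₁)
    {x : Euc (n + 1)} (hx : x ∉ prodSet n Z₀ Z₁) :
    ContDiffAt ℝ (⊤ : ℕ∞) (jumpEuc n ν₀ Z₁) x := by
  refine ContDiffAt.comp (g := jumpFun ν₀ (prodDist n Z₁)) x ?_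
    (splitCLE (0 : Fin (n + 1))).contDiff.contDiffAt
  refine contDiffAt_jumpFun h₀ (lipschitzWith_prodDist Z₁) (prodDist_nonneg Z₁) ?_
  by_cases hx0 : x 0 ∈ Z₀
  · right
    have : ∃ j : Fin n, x j.succ ∉ Z₁ := by
      by_contra! h
      exact hx ⟨hx0, h⟩
    obtain ⟨j, hj⟩ := this
    exact prodDist_pos h₁.compact.isClosed h₁.nonempty (j := j) (by simpa using hj)
  · exact Or.inl hx0

lemma gradient_jumpEuc_eq_zero (h₀ : IsCantorMeasure β₀ A₀ ν₀ Z₀) {x : Euc (n + 1)}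
    (hx : 2 * prodDist n Z₁ (splitCLE 0 x).2 < Metric.infDist (x 0) Z₀) :
    gradient (jumpEuc n ν₀ Z₁) x = 0 := by
  have h := (splitCLE (0 : Fin (n + 1))).continuous.continuousAt.eventually
    (jumpFun_eventuallyEq_const h₀ (lipschitzWith_prodDist Z₁) (prodDist_nonneg Z₁)
      (p := splitCLE 0 x) hx)
  have h2 : jumpEuc n ν₀ Z₁ =ᶠ[𝓝 x] fun _ => ∫ v, Real.sign ((splitCLE 0 x).1 - v) ∂ν₀ := h
  rw [gradient, h2.fderiv_eq]
  simp

lemma exists_norm_gradient_jumpEuc_le (h₀ : IsCantorMeasure β₀ A₀ ν₀ Z₀) (Z₁ : Set ℝ) : ∃ C : ℝ, 0 < C ∧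
    ∀ x : Euc (n + 1), 0 < prodDist n Z₁ (splitCLE 0 x).2 →
      ‖gradient (jumpEuc n ν₀ Z₁) x‖ ≤ C * prodDist n Z₁ (splitCLE 0 x).2 ^ (-β₀) := by
  obtain ⟨C, hC, hle⟩ := exists_norm_fderiv_jumpFun_le (n := n) h₀
  refine ⟨C, hC, fun x hx => ?_⟩
  have hd : DifferentiableAt ℝ (jumpFun ν₀ (prodDist n Z₁)) (splitCLE 0 x) :=
    (contDiffAt_jumpFun h₀ (lipschitzWith_prodDist Z₁) (prodDist_nonneg Z₁)
      (Or.inr hx)).differentiableAt (by simp)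
  have h := hd.hasFDerivAt.comp x (splitCLE (0 : Fin (n + 1))).hasFDerivAt
  have h' : fderiv ℝ (jumpEuc n ν₀ Z₁) x = _ := h.fderiv
  rw [norm_gradient, h']
  refine (ContinuousLinearMap.opNorm_comp_le _ _).trans ?_
  have hn : ‖((splitCLE (0 : Fin (n + 1)) : Euc (n + 1) ≃L[ℝ] ℝ × (Fin n → ℝ)) :
      Euc (n + 1) →L[ℝ] ℝ × (Fin n → ℝ))‖ ≤ 1 :=
    ContinuousLinearMap.opNorm_le_bound _ zero_le_one fun y => by
      rw [one_mul]; exact norm_splitCLE_le 0 y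
  calc _ ≤ (C * prodDist n Z₁ (splitCLE 0 x).2 ^ (-β₀)) * 1 := by
        gcongr
        exact hle (lipschitzWith_prodDist Z₁) (prodDist_nonneg Z₁) _ hx
    _ = _ := mul_one _

lemma IsCantorMeasure.integrable_indicator (h : IsCantorMeasure β₀ A₀ ν₀ Z₀) {κ : ℝ} (hκ : 0 < κ)
    (hκ' : κ < β₀) (R : ℝ) :
    Integrable ((Set.Icc (-R) R).indicator fun t => Metric.infDist t Z₀ ^ (-κ)) := by
  rw [integrable_indicator_iff measurableSet_Icc]
  have hm : Measurable fun t => Metric.infDist t Z₀ ^ (-κ) :=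
    (Metric.continuous_infDist_pt Z₀).measurable.pow_const _
  refine ⟨hm.aestronglyMeasurable, ?_⟩
  rw [hasFiniteIntegral_iff_ofReal
    (Eventually.of_forall fun t => Real.rpow_nonneg Metric.infDist_nonneg _)]
  exact h.lintegral_lt_top κ R hκ hκ'

lemma integrable_prod_infDist (h₀ : IsCantorMeasure β₀ A₀ ν₀ Z₀)
    (h₁ : IsCantorMeasure β₁ A₁ ν₁ Z₁) {κ₀ κ₁ : ℝ} (h0 : 0 < κ₀) (h0' : κ₀ < β₀) (h1 : 0 < κ₁)
    (h1' : κ₁ < β₁) (R : ℝ) :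
    Integrable fun x : Euc (n + 1) =>
      (Set.Icc (-R) R).indicator (fun t => Metric.infDist t Z₀ ^ (-κ₀)) (x 0) *
      ∏ j : Fin n, (Set.Icc (-R) R).indicator (fun t => Metric.infDist t Z₁ ^ (-κ₁)) (x j.succ) := by
  have h2 : Integrable (fun p : ℝ × (Fin n → ℝ) =>
      (Set.Icc (-R) R).indicator (fun t => Metric.infDist t Z₀ ^ (-κ₀)) p.1 *
      ∏ j : Fin n, (Set.Icc (-R) R).indicator (fun t => Metric.infDist t Z₁ ^ (-κ₁)) (p.2 j))
      (volume.prod volume) :=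
    (h₀.integrable_indicator h0 h0' R).mul_prod
      (Integrable.fintype_prod (μ := fun _ : Fin n => (volume : Measure ℝ))
        fun _ => h₁.integrable_indicator h1 h1' R)
  have h3 := ((measurePreserving_splitCLE (0 : Fin (n + 1))).integrable_comp_emb
    (measurableEmbedding_splitCLE 0)).2 h2
  simpa [Function.comp_def] using h3

lemma integrableOn_norm_gradient_rpow (hn : 0 < n) (h₀ : IsCantorMeasure β₀ A₀ ν₀ Z₀)
    (h₁ : IsCantorMeasure β₁ A₁ ν₁ Z₁) {p : ℝ} (hp : 1 < p) (hβ₀ : 0 < β₀)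
    (h : (p - 1) * β₀ < n * β₁) :
    IntegrableOn (fun x => ‖gradient (jumpEuc n ν₀ Z₁) x‖ ^ p) (Omg (n + 1)) := by
  have hn' : (0 : ℝ) < n := Nat.cast_pos.2 hn
  obtain ⟨κ, hκ1, hκ2⟩ := exists_between
    (show (p - 1) * β₀ < min (n * β₁) (p * β₀) from lt_min h (by nlinarith))
  have hκ3 := hκ2.trans_le (min_le_left _ _)
  have hκ4 := hκ2.trans_le (min_le_right _ _)
  have hκ0 : 0 < κ := lt_of_le_of_lt (by nlinarith) hκ1
  set κ₀ := p * β₀ - κ with hκ₀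
  obtain ⟨C, hC, hle⟩ := exists_norm_gradient_jumpEuc_le (n := n) h₀ Z₁
  set R := Real.sqrt ((n + 1 : ℕ) : ℝ) with hR
  have hint := (integrable_prod_infDist (n := n) h₀ h₁ (κ₀ := κ₀) (κ₁ := κ / n)
    (by linarith) (by rw [hκ₀]; linarith) (by positivity)
    (by rw [div_lt_iff₀ hn']; linarith) R).const_mul (C ^ p * 2 ^ κ₀)
  refine hint.integrableOn.mono'
    ((measurable_gradient _).norm.pow_const p).aestronglyMeasurable ?_
  have hae0 := measure_eq_zero_iff_ae_notMem.1 (volume_apply_mem_eq_zero (0 : Fin (n + 1)) h₀.null)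
  have hae1 : ∀ᵐ x : Euc (n + 1), ∀ j : Fin n, x j.succ ∉ Z₁ := ae_all_iff.2 fun j =>
    measure_eq_zero_iff_ae_notMem.1 (volume_apply_mem_eq_zero j.succ h₁.null)
  rw [ae_restrict_iff' (show MeasurableSet (Omg (n + 1)) from Metric.isOpen_ball.measurableSet)]
  filter_upwards [hae0, hae1] with x hx0 hx1 hxΩ
  have hd0 : 0 < Metric.infDist (x 0) Z₀ :=
    (h₀.compact.isClosed.notMem_iff_infDist_pos h₀.nonempty).1 hx0
  have hd1 : ∀ j : Fin n, 0 < Metric.infDist (x j.succ) Z₁ := fun j =>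
    (h₁.compact.isClosed.notMem_iff_infDist_pos h₁.nonempty).1 (hx1 j)
  have hxR : ∀ i, x i ∈ Set.Icc (-R) R := fun i => by
    rw [Omg, mem_ball_zero_iff] at hxΩ
    exact abs_le.1 ((PiLp.norm_apply_le x i).trans hxΩ.le)
  rw [Set.indicator_of_mem (hxR 0)]
  simp_rw [Set.indicator_of_mem (hxR _)]
  rw [Real.norm_of_nonneg (by positivity)]
  set y := (splitCLE 0 x).2 with hy
  set d := prodDist n Z₁ y with hd
  have hyj : ∀ j : Fin n, y j = x j.succ := fun j => by simp [hy]
  have hdj : ∀ j : Fin n, Metric.infDist (x j.succ) Z₁ ≤ d := fun j => by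
    rw [← hyj]; exact infDist_le_prodDist Z₁ y j
  have hdp : 0 < d := (hd1 ⟨0, hn⟩).trans_le (hdj _)
  by_cases hcase : 2 * d < Metric.infDist (x 0) Z₀
  · rw [gradient_jumpEuc_eq_zero h₀ hcase, norm_zero, Real.zero_rpow (by linarith)]
    have : ∀ j ∈ Finset.univ, 0 ≤ Metric.infDist (x (Fin.succ j)) Z₁ ^ (-(κ / n)) :=
      fun j _ => Real.rpow_nonneg Metric.infDist_nonneg _
    have := Finset.prod_nonneg this
    positivity
  rw [not_lt] at hcase
  have e1 : d ^ (-κ₀) ≤ 2 ^ κ₀ * Metric.infDist (x 0) Z₀ ^ (-κ₀) := by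
    have : d ^ (-κ₀) ≤ (Metric.infDist (x 0) Z₀ / 2) ^ (-κ₀) :=
      Real.rpow_le_rpow_of_nonpos (by positivity) (by linarith) (by linarith)
    rw [Real.div_rpow hd0.le zero_le_two, Real.rpow_neg zero_le_two, div_inv_eq_mul, mul_comm] at this
    exact this
  have e2 : d ^ (-κ) ≤ ∏ j : Fin n, Metric.infDist (x j.succ) Z₁ ^ (-(κ / n)) := by
    have : d ^ (-κ) = ∏ _j : Fin n, d ^ (-(κ / n)) := by
      rw [Finset.prod_const, Finset.card_univ, Fintype.card_fin, ← Real.rpow_natCast,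
        ← Real.rpow_mul hdp.le]
      congr 1
      field_simp
    rw [this]
    refine Finset.prod_le_prod (fun j _ => by positivity) fun j _ => ?_
    exact Real.rpow_le_rpow_of_nonpos (hd1 j) (hdj j) (by
      have : 0 < κ / n := by positivity
      linarith)
  calc ‖gradient (jumpEuc n ν₀ Z₁) x‖ ^ p ≤ (C * d ^ (-β₀)) ^ p := by
        gcongr
        exact hle x hdp
    _ = C ^ p * (d ^ (-κ₀) * d ^ (-κ)) := by
        rw [Real.mul_rpow hC.le (by positivity), ← Real.rpow_mul hdp.le, ← Real.rpow_add hdp]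
        congr 2
        rw [hκ₀]; ring
    _ ≤ C ^ p * ((2 ^ κ₀ * Metric.infDist (x 0) Z₀ ^ (-κ₀)) *
          ∏ j : Fin n, Metric.infDist (x j.succ) Z₁ ^ (-(κ / n))) := by gcongr
    _ = _ := by ring

lemma integrableOn_of_integrableOn_norm_rpow {N : ℕ} {g : Euc N → Euc N} (hg : Measurable g)
    {p : ℝ} (hp : 1 < p) (h : IntegrableOn (fun x => ‖g x‖ ^ p) (Omg N)) :
    IntegrableOn g (Omg N) := by
  have h1 : IntegrableOn (fun _ : Euc N => (1 : ℝ)) (Omg N) :=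
    integrableOn_const measure_ball_lt_top.ne
  refine (h1.add h).mono' hg.aestronglyMeasurable (Eventually.of_forall fun x => ?_)
  rw [Pi.add_apply]
  rcases le_or_gt ‖g x‖ 1 with hx | hx
  · have : 0 ≤ ‖g x‖ ^ p := by positivity
    linarith
  · have := Real.self_le_rpow_of_one_le hx.le hp.le
    linarith

end

section

variable {n : ℕ}

lemma lintegral_comp_smul_closedBall {G : (Fin n → ℝ) → ℝ≥0∞} (hG : Measurable G)
    {r d : ℝ} (hd : 0 < d) (y : Fin n → ℝ) :
    ∫⁻ z in Metric.closedBall 0 r, G (y + d • z) =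
      ENNReal.ofReal (d ^ n)⁻¹ * ∫⁻ u in Metric.closedBall y (d * r), G u := by
  set F : (Fin n → ℝ) → ℝ≥0∞ := (Metric.closedBall y (d * r)).indicator G with hF
  have hFm : Measurable F := hG.indicator Metric.isClosed_closedBall.measurableSet
  have h1 : ∀ z, (Metric.closedBall (0 : Fin n → ℝ) r).indicator (fun z => G (y + d • z)) z =
      F (y + d • z) := by
    intro z
    have : y + d • z ∈ Metric.closedBall y (d * r) ↔ z ∈ Metric.closedBall 0 r := by
      simp [norm_smul, abs_of_pos hd, hd]
    by_cases hz : z ∈ Metric.closedBall 0 r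
    · rw [Set.indicator_of_mem hz, hF, Set.indicator_of_mem (this.2 hz)]
    · rw [Set.indicator_of_notMem hz, hF, Set.indicator_of_notMem fun h => hz (this.1 h)]
  rw [← lintegral_indicator Metric.isClosed_closedBall.measurableSet,
    ← lintegral_indicator Metric.isClosed_closedBall.measurableSet, ← hF]
  simp_rw [h1]
  have h2 : ∫⁻ z, F (y + d • z) = ∫⁻ v, F (y + v) ∂(Measure.map (d • ·) volume) := by
    exact (lintegral_map (f := fun v => F (y + v)) (hFm.comp (measurable_const_add y))
      (measurable_const_smul d)).symm
  rw [h2, Measure.map_addHaar_smul _ hd.ne', lintegral_smul_measure, lintegral_add_left_eq_self,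
    Module.finrank_fin_fun, abs_of_pos (by positivity), smul_eq_mul]

lemma lintegral_lintegral_closedBall_le {β A : ℝ} {ν : Measure ℝ} {Z : Set ℝ}
    (h : IsCantorMeasure β A ν Z) {G : (Fin n → ℝ) → ℝ≥0∞} (hG : Measurable G) {r d : ℝ}
    (hr : 0 < r) (hd : 0 < d) :
    ∫⁻ y, (∫⁻ z in Metric.closedBall 0 r, G (y + d • z)) ∂(Measure.pi fun _ : Fin n => ν) ≤
      ENNReal.ofReal ((A * r ^ (1 - β)) ^ n * d ^ (-(n * β))) * ∫⁻ u, G u := by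
  have := h.prob
  have hA := h.pos
  simp_rw [lintegral_comp_smul_closedBall hG hd]
  set T : Set ((Fin n → ℝ) × (Fin n → ℝ)) := {q | dist q.2 q.1 ≤ d * r} with hT
  have hTm : MeasurableSet T :=
    (isClosed_le (continuous_snd.dist continuous_fst) continuous_const).measurableSet
  have hm : Measurable (T.indicator fun q => G q.2) := (hG.comp measurable_snd).indicator hTm
  have h1 : ∀ y, ∫⁻ u in Metric.closedBall y (d * r), G u =
      ∫⁻ u, T.indicator (fun q => G q.2) (y, u) := by
    intro y
    rw [← lintegral_indicator Metric.isClosed_closedBall.measurableSet]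
    rfl
  have hm2 : Measurable fun y => ∫⁻ u, T.indicator (fun q => G q.2) (y, u) :=
    hm.lintegral_prod_right'
  simp_rw [h1]
  rw [lintegral_const_mul _ hm2, 
    lintegral_lintegral_swap (f := fun y u => T.indicator (fun q => G q.2) (y, u)) hm.aemeasurable]
  have h2 : ∀ u, ∫⁻ y, T.indicator (fun q => G q.2) (y, u) ∂(Measure.pi fun _ : Fin n => ν) ≤
      ENNReal.ofReal ((A * (d * r) ^ (1 - β)) ^ n) * G u := by
    intro u
    have e1 : (fun y => T.indicator (fun q => G q.2) (y, u)) =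
        (Metric.closedBall u (d * r)).indicator fun _ => G u := by
      ext y
      simp only [Set.indicator, hT, Set.mem_ofPred_eq, Metric.mem_closedBall, dist_comm]
    rw [e1, lintegral_indicator_const Metric.isClosed_closedBall.measurableSet,
      Measure.pi_closedBall _ _ (by positivity), mul_comm, ENNReal.ofReal_pow (by positivity)]
    gcongr
    calc ∏ i, ν (Metric.closedBall (u i) (d * r))
        ≤ ∏ _i : Fin n, ENNReal.ofReal (A * (d * r) ^ (1 - β)) :=
          Finset.prod_le_prod' fun i _ => h.frostman (u i) (d * r) (by positivity)
      _ = _ := by simp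
  calc _ ≤ ENNReal.ofReal (d ^ n)⁻¹ *
        ∫⁻ u, ENNReal.ofReal ((A * (d * r) ^ (1 - β)) ^ n) * G u := by
        gcongr with u
        exact h2 u
    _ = _ := by
      rw [lintegral_const_mul _ hG, ← mul_assoc, ← ENNReal.ofReal_mul (by positivity)]
      congr 2
      have e3 : d ^ (-(n * β)) = (d ^ n)⁻¹ * (d ^ (1 - β)) ^ n := by
        rw [← Real.rpow_natCast, ← Real.rpow_natCast, ← Real.rpow_mul hd.le, ← Real.rpow_neg hd.le,
          ← Real.rpow_add hd]
        congr 1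
        ring
      rw [e3, Real.mul_rpow hd.le hr.le]
      ring

lemma ofReal_abs_sub_le_lintegral_norm_fderiv {E : Type*} [NormedAddCommGroup E]
    [NormedSpace ℝ E] [FiniteDimensional ℝ E] {Ψ : E → ℝ} {U : Set E} (hU : IsOpen U)
    (hΨ : ContDiffOn ℝ 1 Ψ U) {γ : ℝ → E} (hγ : LipschitzWith 1 γ) {a b : ℝ} (hab : a ≤ b)
    (hγU : ∀ t ∈ Set.Icc a b, γ t ∈ U) :
    ENNReal.ofReal |Ψ (γ b) - Ψ (γ a)| ≤
      ∫⁻ t in Set.Icc a b, ENNReal.ofReal ‖fderiv ℝ Ψ (γ t)‖ := by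
  have hloc : LocallyLipschitzOn (Set.Icc a b) (Ψ ∘ γ) := by
    intro t ht
    obtain ⟨K, s, hs, hK⟩ := (hΨ.contDiffAt (hU.mem_nhds (hγU t ht))).exists_lipschitzOnWith
    refine ⟨K * 1, γ ⁻¹' s, mem_nhdsWithin_of_mem_nhds (hγ.continuous.continuousAt hs), ?_⟩
    exact hK.comp hγ.lipschitzOnWith (Set.mapsTo_preimage _ _)
  obtain ⟨K, hK⟩ := hloc.exists_lipschitzOnWith_of_compact isCompact_Icc
  rw [← Set.uIcc_of_le hab] at hK
  have hac := hK.absolutelyContinuousOnInterval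
  have h1 := hac.integral_deriv_eq_sub
  rw [intervalIntegral.integral_of_le hab, ← integral_Icc_eq_integral_Ioc] at h1
  simp only [Function.comp] at h1
  rw [← h1, ← Real.norm_eq_abs, ofReal_norm]
  refine (enorm_integral_le_lintegral_enorm _).trans ?_
  refine lintegral_mono_ae ?_
  rw [ae_restrict_iff' measurableSet_Icc]
  filter_upwards [hγ.ae_differentiableAt (μ := volume)] with t ht htI
  have hd : DifferentiableAt ℝ Ψ (γ t) :=
    (hΨ.contDiffAt (hU.mem_nhds (hγU t htI))).differentiableAt (by simp)
  have hc := hd.hasFDerivAt.comp_hasDerivAt t ht.hasDerivAt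
  rw [← ofReal_norm]
  refine ENNReal.ofReal_le_ofReal ?_
  have hc' : deriv (Ψ ∘ γ) t = fderiv ℝ Ψ (γ t) (deriv γ t) := hc.deriv
  rw [hc']
  refine (ContinuousLinearMap.le_opNorm _ _).trans ?_
  have := norm_deriv_le_of_lipschitz (x₀ := t) hγ
  exact mul_le_of_le_one_right (norm_nonneg _) (by simpa using this)

end

section

variable {n : ℕ} {β₀ A₀ β₁ A₁ : ℝ} {ν₀ ν₁ : Measure ℝ} {Z₀ Z₁ : Set ℝ}

/-- The curve over the first axis which starts at `y` on `Z` and moves in direction `z`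
according to the distance to `Z`. -/
def distCurve (Z : Set ℝ) (θ : (Fin n → ℝ) × (Fin n → ℝ)) (t : ℝ) : ℝ × (Fin n → ℝ) :=
  (t, θ.1 + Metric.infDist t Z • θ.2)

lemma continuous_uncurry_distCurve (Z : Set ℝ) :
    Continuous (Function.uncurry (distCurve (n := n) Z)) := by
  have : Continuous fun t : ℝ => Metric.infDist t Z := Metric.continuous_infDist_pt Z
  unfold distCurve Function.uncurry
  fun_prop

/-- The measure on the parameters of the curves `distCurve`. -/
def curveMeasure (n : ℕ) (ν : Measure ℝ) : Measure ((Fin n → ℝ) × (Fin n → ℝ)) :=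
  (Measure.pi fun _ => ν).prod (volume.restrict (Metric.closedBall 0 (1 / 8)))

instance [IsProbabilityMeasure ν₁] : IsFiniteMeasure (curveMeasure n ν₁) := by
  have : IsFiniteMeasure ((volume : Measure (Fin n → ℝ)).restrict (Metric.closedBall 0 (1 / 8))) :=
    
    ⟨by rw [Measure.restrict_apply_univ]; exact measure_closedBall_lt_top⟩
  unfold curveMeasure
  infer_instance

lemma curveMeasure_univ_pos [IsProbabilityMeasure ν₁] : 0 < curveMeasure n ν₁ Set.univ := by
  rw [curveMeasure, ← Set.univ_prod_univ, Measure.prod_prod]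
  simp only [measure_univ, one_mul, Measure.restrict_apply_univ]
  exact Metric.measure_closedBall_pos _ _ (by norm_num)

lemma ae_curveMeasure (h₁ : IsCantorMeasure β₁ A₁ ν₁ Z₁) :
    ∀ᵐ θ ∂curveMeasure n ν₁, (∀ j, θ.1 j ∈ Z₁) ∧ ‖θ.2‖ ≤ 1 / 8 := by
  have := h₁.prob
  have e1 : ∀ᵐ y ∂(Measure.pi fun _ : Fin n => ν₁), ∀ j, y j ∈ Z₁ := by
    rw [ae_all_iff]
    intro j
    exact (measurePreserving_eval (fun _ : Fin n => ν₁) j).quasiMeasurePreserving.ae h₁.ae_mem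
  have e2 : ∀ᵐ z ∂(volume : Measure (Fin n → ℝ)).restrict (Metric.closedBall 0 (1 / 8)),
      ‖z‖ ≤ 1 / 8 := by
    filter_upwards [ae_restrict_mem Metric.isClosed_closedBall.measurableSet] with z hz
    simpa using hz
  filter_upwards [Measure.quasiMeasurePreserving_fst.ae e1,
    Measure.quasiMeasurePreserving_snd.ae e2] with θ a b using ⟨a, b⟩

lemma lintegral_distCurve_le (h₀ : IsCantorMeasure β₀ A₀ ν₀ Z₀) (h₁ : IsCantorMeasure β₁ A₁ ν₁ Z₁)
    {G : ℝ × (Fin n → ℝ) → ℝ≥0∞} (hG : Measurable G) :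
    ∫⁻ θ, (∫⁻ s, G (distCurve Z₀ θ s)) ∂curveMeasure n ν₁ ≤
      ∫⁻ p, ENNReal.ofReal ((A₁ * (1 / 8) ^ (1 - β₁)) ^ n *
        Metric.infDist p.1 Z₀ ^ (-(n * β₁))) * G p := by
  have := h₁.prob
  have hm : Measurable (Function.uncurry fun θ s => G (distCurve (n := n) Z₀ θ s)) :=
    hG.comp (continuous_uncurry_distCurve Z₀).measurable
  rw [lintegral_lintegral_swap hm.aemeasurable, Measure.volume_eq_prod, lintegral_prod]
  · refine lintegral_mono_ae ?_
    have hz : ∀ᵐ s : ℝ, s ∉ Z₀ := measure_eq_zero_iff_ae_notMem.1 h₀.null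
    filter_upwards [hz] with s hs
    have hd : 0 < Metric.infDist s Z₀ :=
      (h₀.compact.isClosed.notMem_iff_infDist_pos h₀.nonempty).1 hs
    have hGs : Measurable fun u => G (s, u) := hG.comp measurable_prodMk_left
    have hms : Measurable fun θ => G (distCurve (n := n) Z₀ θ s) :=
      hG.comp ((continuous_uncurry_distCurve Z₀).comp (by fun_prop :
        Continuous fun θ : (Fin n → ℝ) × (Fin n → ℝ) => (θ, s))).measurable
    rw [curveMeasure, lintegral_prod _ hms.aemeasurable, lintegral_const_mul _ hGs]
    exact lintegral_lintegral_closedBall_le h₁ hGs (by norm_num) hd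
  · have : Continuous fun p : ℝ × (Fin n → ℝ) => Metric.infDist p.1 Z₀ :=
      (Metric.continuous_infDist_pt Z₀).comp continuous_fst
    have := this.measurable
    exact Measurable.aemeasurable (by fun_prop)

/-- The region in which the curves `distCurve` run. -/
def coneSet (n : ℕ) (Z₀ Z₁ : Set ℝ) : Set (ℝ × (Fin n → ℝ)) :=
  {p | |p.1| ≤ 1 / 2 ∧ ‖p‖ < 1 ∧ 8 * prodDist n Z₁ p.2 ≤ Metric.infDist p.1 Z₀}

lemma measurableSet_coneSet : MeasurableSet (coneSet n Z₀ Z₁) := by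
  have h1 : Continuous fun p : ℝ × (Fin n → ℝ) => Metric.infDist p.1 Z₀ :=
    (Metric.continuous_infDist_pt Z₀).comp continuous_fst
  have h2 : Continuous fun p : ℝ × (Fin n → ℝ) => prodDist n Z₁ p.2 :=
    (lipschitzWith_prodDist Z₁).continuous.comp continuous_snd
  have e1 := (isClosed_le (continuous_fst (X := ℝ) (Y := Fin n → ℝ)).abs
    (continuous_const (y := (1 / 2 : ℝ)))).measurableSet
  have e2 := (isOpen_lt (continuous_norm (E := ℝ × (Fin n → ℝ)))
    (continuous_const (y := (1 : ℝ)))).measurableSet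
  have e3 := (isClosed_le ((continuous_const (y := (8 : ℝ))).mul h2) h1).measurableSet
  exact e1.inter (e2.inter e3)

lemma lipschitzWith_distCurve {θ : (Fin n → ℝ) × (Fin n → ℝ)} (hθ : ‖θ.2‖ ≤ 1 / 8) :
    LipschitzWith 1 (distCurve Z₀ θ) := by
  refine LipschitzWith.of_dist_le_mul fun s t => ?_
  have h1 := (Metric.lipschitz_infDist_pt Z₀).dist_le_mul s t
  simp only [NNReal.coe_one, one_mul] at h1 ⊢
  rw [distCurve, distCurve, Prod.dist_eq, max_le_iff]
  refine ⟨le_rfl, ?_⟩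
  rw [dist_add_left, dist_eq_norm, ← sub_smul, norm_smul, ← dist_eq_norm]
  nlinarith [norm_nonneg θ.2, dist_nonneg (x := s) (y := t),
    dist_nonneg (x := Metric.infDist s Z₀) (y := Metric.infDist t Z₀)]

lemma IsCantorMeasure.infDist_le (h₀ : IsCantorMeasure β₀ A₀ ν₀ Z₀) {t : ℝ} (ht : |t| ≤ 1 / 2) :
    Metric.infDist t Z₀ ≤ 3 / 4 := by
  obtain ⟨v, hv⟩ := h₀.nonempty
  have hv' := h₀.subset hv
  have := infDist_le_abs_sub hv (t := t)
  have h3 := abs_sub t v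
  rw [abs_of_nonneg hv'.1] at h3
  linarith [hv'.2]

lemma distCurve_mem_coneSet (h₀ : IsCantorMeasure β₀ A₀ ν₀ Z₀) (h₁ : IsCantorMeasure β₁ A₁ ν₁ Z₁)
    {θ : (Fin n → ℝ) × (Fin n → ℝ)} (hy : ∀ j, θ.1 j ∈ Z₁) (hθ : ‖θ.2‖ ≤ 1 / 8) {t : ℝ}
    (ht : |t| ≤ 1 / 2) : distCurve Z₀ θ t ∈ coneSet n Z₀ Z₁ := by
  have hd0 : 0 ≤ Metric.infDist t Z₀ := Metric.infDist_nonneg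
  have hd : Metric.infDist t Z₀ ≤ 3 / 4 := h₀.infDist_le ht
  have hs : ‖Metric.infDist t Z₀ • θ.2‖ ≤ Metric.infDist t Z₀ / 8 := by
    rw [norm_smul, Real.norm_of_nonneg hd0]
    nlinarith
  have hy1 : ‖θ.1‖ ≤ 1 / 4 := by
    refine (pi_norm_le_iff_of_nonneg (by norm_num)).2 fun j => ?_
    have := h₁.subset (hy j)
    rw [Real.norm_of_nonneg this.1]
    exact this.2
  refine ⟨ht, ?_, ?_⟩
  · rw [distCurve, Prod.norm_def, max_lt_iff]
    refine ⟨lt_of_le_of_lt ht (by norm_num), ?_⟩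
    have := norm_add_le θ.1 (Metric.infDist t Z₀ • θ.2)
    simp only
    linarith
  · have := prodDist_le_of_mem hy (y := (distCurve Z₀ θ t).2)
    simp only [distCurve, add_sub_cancel_left] at this ⊢
    linarith

/-- The distance of `Ψ` from the jump function on the part of `coneSet` away from the jump. -/
def outerError (n : ℕ) (ν₀ : Measure ℝ) (Z₀ Z₁ : Set ℝ) (Ψ : ℝ × (Fin n → ℝ) → ℝ) :
    ℝ × (Fin n → ℝ) → ℝ≥0∞ :=
  (coneSet n Z₀ Z₁ ∩ {p | 3 / 8 ≤ |p.1|}).indicator fun p =>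
    ENNReal.ofReal |Ψ p - jumpFun ν₀ (prodDist n Z₁) p|

lemma IsCantorMeasure.le_infDist (h₀ : IsCantorMeasure β₀ A₀ ν₀ Z₀) {t : ℝ} (ht : 3 / 8 ≤ |t|) :
    1 / 8 ≤ Metric.infDist t Z₀ := by
  refine (Metric.le_infDist h₀.nonempty).2 fun v hv => ?_
  have := h₀.subset hv
  have h3 := abs_sub_abs_le_abs_sub t v
  rw [abs_of_nonneg this.1] at h3
  rw [Real.dist_eq]
  linarith [this.2]

lemma jumpFun_eq_of_mem_coneSet (h₀ : IsCantorMeasure β₀ A₀ ν₀ Z₀) {p : ℝ × (Fin n → ℝ)}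
    (hp : p ∈ coneSet n Z₀ Z₁) (ht : 3 / 8 ≤ |p.1|) :
    jumpFun ν₀ (prodDist n Z₁) p = if 0 < p.1 then 1 else -1 := by
  have hδ := prodDist_nonneg Z₁ p.2
  have h2 : 2 * prodDist n Z₁ p.2 ≤ Metric.infDist p.1 Z₀ := by linarith [hp.2.2]
  split_ifs with h
  · rw [abs_of_pos h] at ht
    exact jumpFun_eq_one h₀ (lipschitzWith_prodDist Z₁) (prodDist_nonneg Z₁) h2 (by linarith)
  · rw [abs_of_nonpos (not_lt.1 h)] at ht
    exact jumpFun_eq_neg_one h₀ (lipschitzWith_prodDist Z₁) (prodDist_nonneg Z₁) h2 (by linarith)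

lemma coneSet_subset_ball : coneSet n Z₀ Z₁ ⊆ Metric.ball 0 1 := fun p hp => by
  simpa using hp.2.1

lemma measurable_outerError (h₀ : IsCantorMeasure β₀ A₀ ν₀ Z₀) {Ψ : ℝ × (Fin n → ℝ) → ℝ}
    (hΨ : ContinuousOn Ψ (Metric.ball 0 1)) : Measurable (outerError n ν₀ Z₀ Z₁ Ψ) := by
  classical
  have hm : MeasurableSet (coneSet n Z₀ Z₁ ∩ {p | 3 / 8 ≤ |p.1|}) :=
    measurableSet_coneSet.inter (measurableSet_le measurable_const measurable_fst.abs)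
  have hΨm : Measurable ((Metric.ball 0 1).indicator Ψ) := by
    rw [← Set.piecewise_eq_indicator]
    exact hΨ.measurable_piecewise continuousOn_const Metric.isOpen_ball.measurableSet
  have e : outerError n ν₀ Z₀ Z₁ Ψ = (coneSet n Z₀ Z₁ ∩ {p | 3 / 8 ≤ |p.1|}).indicator fun p =>
      ENNReal.ofReal |(Metric.ball 0 1).indicator Ψ p - if 0 < p.1 then 1 else -1| := by
    refine Set.indicator_congr fun p hp => ?_
    rw [Set.indicator_of_mem (coneSet_subset_ball hp.1), jumpFun_eq_of_mem_coneSet h₀ hp.1 hp.2]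
  rw [e]
  have : Measurable fun p : ℝ × (Fin n → ℝ) => if 0 < p.1 then (1 : ℝ) else -1 :=
    Measurable.ite (measurableSet_lt measurable_const measurable_fst) measurable_const
      measurable_const
  exact (hΨm.sub this).abs.ennreal_ofReal.indicator hm

lemma ofReal_le_lintegral_distCurve (h₀ : IsCantorMeasure β₀ A₀ ν₀ Z₀)
    (h₁ : IsCantorMeasure β₁ A₁ ν₁ Z₁) {Ψ : ℝ × (Fin n → ℝ) → ℝ}
    (hΨ : ContDiffOn ℝ 1 Ψ (Metric.ball 0 1)) {θ : (Fin n → ℝ) × (Fin n → ℝ)}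
    (hy : ∀ j, θ.1 j ∈ Z₁) (hθ : ‖θ.2‖ ≤ 1 / 8) :
    ENNReal.ofReal (1 / 4) ≤ 2 * (∫⁻ s, outerError n ν₀ Z₀ Z₁ Ψ (distCurve Z₀ θ s)) +
      ∫⁻ s, (coneSet n Z₀ Z₁).indicator (fun p => ENNReal.ofReal ‖fderiv ℝ Ψ p‖)
        (distCurve Z₀ θ s) := by
  set F := outerError n ν₀ Z₀ Z₁ Ψ with hF
  set γ := distCurve Z₀ θ with hγ
  set I := ∫⁻ s, (coneSet n Z₀ Z₁).indicator (fun p => ENNReal.ofReal ‖fderiv ℝ Ψ p‖) (γ s) with hI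
  have hγL : LipschitzWith 1 γ := lipschitzWith_distCurve hθ
  have hmem : ∀ t, |t| ≤ 1 / 2 → γ t ∈ coneSet n Z₀ Z₁ := fun t ht =>
    distCurve_mem_coneSet h₀ h₁ hy hθ ht
  have hFm : Measurable fun t => F (γ t) :=
    (measurable_outerError h₀ hΨ.continuousOn).comp hγL.continuous.measurable
  have key : ∀ t ∈ Set.Icc (3 / 8 : ℝ) (1 / 2),
      ENNReal.ofReal 2 ≤ F (γ t) + F (γ (-t)) + I := by
    intro t ht
    have ht0 : 0 < t := by linarith [ht.1]
    have hFv : ∀ s, |s| = t →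
        F (γ s) = ENNReal.ofReal |Ψ (γ s) - if 0 < s then 1 else -1| := by
      intro s hs
      have h3 : γ s ∈ coneSet n Z₀ Z₁ := hmem s (by rw [hs]; exact ht.2)
      have h4 : 3 / 8 ≤ |(γ s).1| := by
        change 3 / 8 ≤ |s|
        rw [hs]
        exact ht.1
      have h5 : γ s ∈ coneSet n Z₀ Z₁ ∩ {p | 3 / 8 ≤ |p.1|} := ⟨h3, h4⟩
      rw [hF, outerError, Set.indicator_of_mem h5, jumpFun_eq_of_mem_coneSet h₀ h3 h4]
      rfl
    have hIle : ENNReal.ofReal |Ψ (γ t) - Ψ (γ (-t))| ≤ I := by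
      refine (ofReal_abs_sub_le_lintegral_norm_fderiv Metric.isOpen_ball hΨ hγL (by linarith)
        fun s hs => coneSet_subset_ball (hmem s ?_)).trans ?_
      · exact (abs_le.2 hs).trans ht.2
      · rw [← lintegral_indicator measurableSet_Icc, hI]
        refine lintegral_mono fun s => ?_
        by_cases hs : s ∈ Set.Icc (-t) t
        · rw [Set.indicator_of_mem hs, Set.indicator_of_mem (hmem s ((abs_le.2 hs).trans ht.2))]
        · rw [Set.indicator_of_notMem hs]
          exact zero_le
    rw [hFv t (abs_of_pos ht0), hFv (-t) (by rw [abs_neg, abs_of_pos ht0]), if_pos ht0,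
      if_neg (by linarith)]
    refine le_trans ?_ (add_le_add le_rfl hIle)
    rw [← ENNReal.ofReal_add (abs_nonneg _) (abs_nonneg _),
      ← ENNReal.ofReal_add (by positivity) (abs_nonneg _)]
    refine ENNReal.ofReal_le_ofReal ?_
    have a1 := neg_abs_le (Ψ (γ t) - 1)
    have a2 := le_abs_self (Ψ (γ (-t)) - -1)
    have a3 := le_abs_self (Ψ (γ t) - Ψ (γ (-t)))
    linarith
  have hJ : volume (Set.Icc (3 / 8 : ℝ) (1 / 2)) = ENNReal.ofReal (1 / 8) := by
    rw [Real.volume_Icc]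
    norm_num
  calc ENNReal.ofReal (1 / 4) = ∫⁻ _t in Set.Icc (3 / 8 : ℝ) (1 / 2), ENNReal.ofReal 2 := by
        rw [setLIntegral_const, hJ, ← ENNReal.ofReal_mul (by norm_num)]
        norm_num
    _ ≤ ∫⁻ t in Set.Icc (3 / 8 : ℝ) (1 / 2), (F (γ t) + F (γ (-t)) + I) :=
        setLIntegral_mono' measurableSet_Icc key
    _ = (∫⁻ t in Set.Icc (3 / 8 : ℝ) (1 / 2), F (γ t)) +
          (∫⁻ t in Set.Icc (3 / 8 : ℝ) (1 / 2), F (γ (-t))) + I * ENNReal.ofReal (1 / 8) := by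
        rw [lintegral_add_right _ measurable_const, lintegral_add_left hFm, setLIntegral_const, hJ]
    _ ≤ (∫⁻ t, F (γ t)) + (∫⁻ t, F (γ (-t))) + I * 1 := by
        gcongr
        · exact Measure.restrict_le_self
        · exact Measure.restrict_le_self
        · rw [← ENNReal.ofReal_one]
          exact ENNReal.ofReal_le_ofReal (by norm_num)
    _ = _ := by
        have : ∫⁻ t, F (γ (-t)) = ∫⁻ t, F (γ t) := lintegral_neg_eq_self (fun t => F (γ t))
        rw [this, mul_one, two_mul]

end

section

variable {n : ℕ} {β₀ A₀ β₁ A₁ : ℝ} {ν₀ ν₁ : Measure ℝ} {Z₀ Z₁ : Set ℝ}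

lemma le_rpow_mul_rpow_add_rpow {d x q s : ℝ} (hd : 0 < d) (hx : 0 ≤ x) (hq : 1 < q) :
    x ≤ d ^ s * x ^ q + d ^ (-(s / (q - 1))) := by
  have hq' : 0 < q - 1 := by linarith
  by_cases h : x ≤ d ^ (-(s / (q - 1)))
  · have : 0 ≤ d ^ s * x ^ q := by positivity
    linarith
  · push Not at h
    have hx0 : 0 < x := (by positivity : 0 < d ^ (-(s / (q - 1)))).trans h
    have h1 : d ^ (-s) ≤ x ^ (q - 1) := by
      calc d ^ (-s) = (d ^ (-(s / (q - 1)))) ^ (q - 1) := by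
            rw [← Real.rpow_mul hd.le]
            congr 1
            field_simp
        _ ≤ _ := Real.rpow_le_rpow (by positivity) h.le hq'.le
    have h2 : x ^ q = x * x ^ (q - 1) := by
      rw [← Real.rpow_one_add' hx (by linarith)]
      congr 1
      ring
    have h3 : 1 ≤ d ^ s * x ^ (q - 1) := by
      calc 1 = d ^ s * d ^ (-s) := by rw [← Real.rpow_add hd]; simp
        _ ≤ _ := by gcongr
    have h4 : 0 ≤ d ^ (-(s / (q - 1))) := by positivity
    rw [h2]
    nlinarith

lemma exists_le_lintegral_coneSet (h₀ : IsCantorMeasure β₀ A₀ ν₀ Z₀)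
    (h₁ : IsCantorMeasure β₁ A₁ ν₁ Z₁) (hβ₁ : 0 ≤ β₁) {q α : ℝ} (hq : 1 < q)
    (hs0 : 0 < α + n * β₁) (hs : α + n * β₁ < (q - 1) * β₀) :
    ∃ c C M : ℝ≥0∞, c ≠ 0 ∧ C ≠ ⊤ ∧ M ≠ ⊤ ∧ ∀ Ψ : ℝ × (Fin n → ℝ) → ℝ,
      ContDiffOn ℝ 1 Ψ (Metric.ball 0 1) → ∀ l : ℝ, 0 < l →
        c ≤ C * (∫⁻ p in coneSet n Z₀ Z₁,
            ENNReal.ofReal |Ψ p - jumpFun ν₀ (prodDist n Z₁) p|) +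
          ENNReal.ofReal l⁻¹ * (C * (∫⁻ p in coneSet n Z₀ Z₁,
            ENNReal.ofReal (Metric.infDist p.1 Z₀ ^ α * (l * ‖fderiv ℝ Ψ p‖) ^ q)) + M) := by
  have := h₁.prob
  have hA := h₁.pos
  set μ := curveMeasure n ν₁ with hμ
  set K : ℝ := (A₁ * (1 / 8) ^ (1 - β₁)) ^ n with hK
  have hK0 : 0 ≤ K := by positivity
  set s : ℝ := α + n * β₁ with hsdef
  set κ : ℝ := s / (q - 1) with hκ
  have hq' : 0 < q - 1 := by linarith
  set M₀ : ℝ≥0∞ := ∫⁻ t in Set.Icc (-(1 / 2)) (1 / 2), ENNReal.ofReal (Metric.infDist t Z₀ ^ (-κ))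
    with hM₀
  have hM₀t : M₀ < ⊤ :=
    h₀.lintegral_lt_top κ (1 / 2) (by positivity) ((div_lt_iff₀ hq').2 (by linarith))
  have hnb : 0 ≤ n * β₁ := by positivity
  set C : ℝ≥0∞ := 2 * ENNReal.ofReal (K * 8 ^ (n * β₁)) with hC
  have hKC : ENNReal.ofReal K ≤ C := by
    calc ENNReal.ofReal K ≤ ENNReal.ofReal (K * 8 ^ (n * β₁)) := by
          refine ENNReal.ofReal_le_ofReal (le_mul_of_one_le_right hK0 ?_)
          exact Real.one_le_rpow (by norm_num) hnb
      _ ≤ C := by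
          rw [hC]
          exact le_mul_of_one_le_left zero_le (by norm_num)
  refine ⟨ENNReal.ofReal (1 / 4) * μ Set.univ, C, M₀ * μ Set.univ, ?_, by finiteness,
    by finiteness, fun Ψ hΨ l hl => ?_⟩
  · exact mul_ne_zero (by simp) curveMeasure_univ_pos.ne'
  set F := outerError n ν₀ Z₀ Z₁ Ψ with hF
  set D := (coneSet n Z₀ Z₁).indicator (fun p => ENNReal.ofReal ‖fderiv ℝ Ψ p‖) with hD
  set H := (coneSet n Z₀ Z₁).indicator (fun p =>
    ENNReal.ofReal (Metric.infDist p.1 Z₀ ^ s * (l * ‖fderiv ℝ Ψ p‖) ^ q)) with hH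
  have hdm : Measurable fun p : ℝ × (Fin n → ℝ) => Metric.infDist p.1 Z₀ :=
    ((Metric.continuous_infDist_pt Z₀).comp continuous_fst).measurable
  have hfm : Measurable fun p => ‖fderiv ℝ Ψ p‖ := (measurable_fderiv ℝ Ψ).norm
  have hFm : Measurable F := measurable_outerError h₀ hΨ.continuousOn
  have hHm : Measurable H := by
    refine Measurable.indicator ?_ measurableSet_coneSet
    fun_prop
  have hcurve := (continuous_uncurry_distCurve (n := n) Z₀).measurable
  have hX : Measurable fun θ => ∫⁻ t, F (distCurve (n := n) Z₀ θ t) :=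
    (hFm.comp hcurve).lintegral_prod_right'
  have hXH : Measurable fun θ => ∫⁻ t, H (distCurve (n := n) Z₀ θ t) :=
    (hHm.comp hcurve).lintegral_prod_right'
  have hFle : ∫⁻ θ, (∫⁻ t, F (distCurve (n := n) Z₀ θ t)) ∂μ ≤
      ENNReal.ofReal (K * 8 ^ (n * β₁)) * ∫⁻ p in coneSet n Z₀ Z₁,
            ENNReal.ofReal |Ψ p - jumpFun ν₀ (prodDist n Z₁) p| := by
    refine (lintegral_distCurve_le h₀ h₁ hFm).trans ?_
    rw [← lintegral_const_mul' _ _ ENNReal.ofReal_ne_top, ← lintegral_indicator measurableSet_coneSet]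
    refine lintegral_mono fun p => ?_
    by_cases hp : p ∈ coneSet n Z₀ Z₁ ∩ {p | 3 / 8 ≤ |p.1|}
    · rw [hF, outerError, Set.indicator_of_mem hp, Set.indicator_of_mem hp.1]
      gcongr
      have h8 := h₀.le_infDist hp.2
      calc Metric.infDist p.1 Z₀ ^ (-(n * β₁)) ≤ (1 / 8 : ℝ) ^ (-(n * β₁)) :=
            Real.rpow_le_rpow_of_nonpos (by norm_num) h8 (by linarith)
        _ = 8 ^ (n * β₁) := by
            rw [one_div, Real.inv_rpow (by norm_num), Real.rpow_neg (by norm_num), inv_inv]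
    · rw [hF, outerError, Set.indicator_of_notMem hp, mul_zero]
      exact zero_le
  have hHle : ∫⁻ θ, (∫⁻ t, H (distCurve (n := n) Z₀ θ t)) ∂μ ≤
      ENNReal.ofReal K * ∫⁻ p in coneSet n Z₀ Z₁,
            ENNReal.ofReal (Metric.infDist p.1 Z₀ ^ α * (l * ‖fderiv ℝ Ψ p‖) ^ q) := by
    refine (lintegral_distCurve_le h₀ h₁ hHm).trans ?_
    rw [← lintegral_const_mul' _ _ ENNReal.ofReal_ne_top, ← lintegral_indicator measurableSet_coneSet]
    refine lintegral_mono fun p => ?_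
    by_cases hp : p ∈ coneSet n Z₀ Z₁
    · have hd0 : 0 ≤ Metric.infDist p.1 Z₀ := Metric.infDist_nonneg
      rw [hH, Set.indicator_of_mem hp, Set.indicator_of_mem hp,
        ← ENNReal.ofReal_mul (by positivity), ← ENNReal.ofReal_mul hK0]
      refine ENNReal.ofReal_le_ofReal ?_
      rcases hd0.eq_or_lt with hd | hd
      · rw [← hd, Real.zero_rpow hs0.ne']
        simp only [zero_mul, mul_zero]
        positivity
      · refine le_of_eq ?_
        have : Metric.infDist p.1 Z₀ ^ (-(n * β₁)) * Metric.infDist p.1 Z₀ ^ s =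
            Metric.infDist p.1 Z₀ ^ α := by
          rw [← Real.rpow_add hd, hsdef]
          congr 1
          ring
        rw [← this]
        ring
    · rw [hH, Set.indicator_of_notMem hp, mul_zero]
      exact zero_le
  have hDle : ∀ θ, ∫⁻ t, D (distCurve (n := n) Z₀ θ t) ≤
      ENNReal.ofReal l⁻¹ * ((∫⁻ t, H (distCurve (n := n) Z₀ θ t)) + M₀) := by
    intro θ
    have hm1 : Measurable fun t => H (distCurve (n := n) Z₀ θ t) :=
      hHm.comp (hcurve.comp measurable_prodMk_left)
    rw [hM₀, ← lintegral_indicator measurableSet_Icc, ← lintegral_add_left hm1,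
      ← lintegral_const_mul' _ _ ENNReal.ofReal_ne_top]
    refine lintegral_mono_ae ?_
    filter_upwards [measure_eq_zero_iff_ae_notMem.1 h₀.null] with t ht
    have hd : 0 < Metric.infDist t Z₀ :=
      (h₀.compact.isClosed.notMem_iff_infDist_pos h₀.nonempty).1 ht
    by_cases hp : distCurve Z₀ θ t ∈ coneSet n Z₀ Z₁
    · have ht2 : t ∈ Set.Icc (-(1 / 2) : ℝ) (1 / 2) := abs_le.1 hp.1
      rw [hD, hH, Set.indicator_of_mem hp, Set.indicator_of_mem hp, Set.indicator_of_mem ht2,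
        ← ENNReal.ofReal_add (by positivity) (by positivity), ← ENNReal.ofReal_mul (by positivity)]
      refine ENNReal.ofReal_le_ofReal ?_
      have := le_rpow_mul_rpow_add_rpow (s := s) hd
        (by positivity : 0 ≤ l * ‖fderiv ℝ Ψ (distCurve Z₀ θ t)‖) hq
      rw [inv_mul_eq_div, le_div_iff₀' hl]
      exact this
    · rw [hD, Set.indicator_of_notMem hp]
      exact zero_le
  calc ENNReal.ofReal (1 / 4) * μ Set.univ = ∫⁻ _θ, ENNReal.ofReal (1 / 4) ∂μ := by
        rw [lintegral_const]
    _ ≤ ∫⁻ θ, (2 * (∫⁻ t, F (distCurve (n := n) Z₀ θ t)) +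
          ENNReal.ofReal l⁻¹ * ((∫⁻ t, H (distCurve (n := n) Z₀ θ t)) + M₀)) ∂μ := by
        refine lintegral_mono_ae ?_
        filter_upwards [ae_curveMeasure h₁] with θ hθ
        exact (ofReal_le_lintegral_distCurve h₀ h₁ hΨ hθ.1 hθ.2).trans
          (add_le_add le_rfl (hDle θ))
    _ = 2 * (∫⁻ θ, (∫⁻ t, F (distCurve (n := n) Z₀ θ t)) ∂μ) + ENNReal.ofReal l⁻¹ *
          ((∫⁻ θ, (∫⁻ t, H (distCurve (n := n) Z₀ θ t)) ∂μ) + M₀ * μ Set.univ) := by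
        rw [lintegral_add_left (hX.const_mul 2), lintegral_const_mul _ hX,
          lintegral_const_mul' _ _ ENNReal.ofReal_ne_top, lintegral_add_left hXH,
          lintegral_const]
    _ ≤ _ := by
        refine add_le_add ?_ ?_
        · rw [hC, mul_assoc]
          gcongr
        · gcongr
          exact hHle.trans (by gcongr)

end

section

variable {n : ℕ} {β₀ A₀ β₁ A₁ : ℝ} {ν₀ ν₁ : Measure ℝ} {Z₀ Z₁ : Set ℝ}

/-- The weight, supported on a cone in which `jumpEuc` is locally constant. -/
def coneWeight (n : ℕ) (α : ℝ) (Z₀ Z₁ : Set ℝ) (x : Euc (n + 1)) : ℝ :=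
  cutPow α (Metric.infDist (x 0) Z₀ - 2 * prodDist n Z₁ (splitCLE 0 x).2)

lemma abs_coneWeight_sub_le {α : ℝ} (hα : 0 < α) (hα1 : α ≤ 1) (x y : Euc (n + 1)) :
    |coneWeight n α Z₀ Z₁ x - coneWeight n α Z₀ Z₁ y| ≤ 3 ^ α * dist x y ^ α := by
  refine (abs_cutPow_sub_le hα hα1 _ _).trans ?_
  rw [← Real.mul_rpow (by norm_num) dist_nonneg]
  refine Real.rpow_le_rpow (abs_nonneg _) ?_ hα.le
  have h1 : ‖splitCLE 0 x - splitCLE 0 y‖ ≤ dist x y := by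
    rw [← map_sub, dist_eq_norm]
    exact norm_splitCLE_le 0 _
  have h2 := (norm_fst_le _).trans h1
  have h3 := (norm_snd_le _).trans h1
  have h4 := (lipschitzWith_prodDist Z₁).dist_le_mul (splitCLE 0 x).2 (splitCLE 0 y).2
  have h5 : |Metric.infDist (x 0) Z₀ - Metric.infDist (y 0) Z₀| ≤ dist x y :=
    (abs_infDist_sub_le Z₀ _ _).trans h2
  rw [NNReal.coe_one, one_mul, Real.dist_eq, dist_eq_norm] at h4
  have h6 := h4.trans h3
  rw [abs_le] at h5 h6 ⊢
  constructor <;> linarith [h5.1, h5.2, h6.1, h6.2]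

lemma coneWeight_mul_norm_gradient_rpow (h₀ : IsCantorMeasure β₀ A₀ ν₀ Z₀) {α q : ℝ} (hq : q ≠ 0)
    (x : Euc (n + 1)) :
    coneWeight n α Z₀ Z₁ x * ‖gradient (jumpEuc n ν₀ Z₁) x‖ ^ q = 0 := by
  by_cases h : 2 * prodDist n Z₁ (splitCLE 0 x).2 < Metric.infDist (x 0) Z₀
  · rw [gradient_jumpEuc_eq_zero h₀ h, norm_zero, Real.zero_rpow hq, mul_zero]
  · rw [coneWeight, cutPow, if_neg (by linarith), zero_mul]

lemma mul_rpow_le_coneWeight {α : ℝ} (h0 : 0 ≤ α) (h1 : α ≤ 1) {p : ℝ × (Fin n → ℝ)}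
    (hp : p ∈ coneSet n Z₀ Z₁) (hd : 0 < Metric.infDist p.1 Z₀)
    (hd1 : Metric.infDist p.1 Z₀ ≤ 4 / 3) :
    Metric.infDist p.1 Z₀ ^ α ≤ 4 / 3 * coneWeight n α Z₀ Z₁ ((splitCLE 0).symm p) := by
  have h := hp.2.2
  rw [coneWeight, splitCLE_symm_same, ContinuousLinearEquiv.apply_symm_apply, cutPow,
    if_pos (by linarith)]
  set d := Metric.infDist p.1 Z₀
  calc d ^ α = 4 / 3 * ((3 / 4) ^ (1 : ℝ) * d ^ α) := by rw [Real.rpow_one]; ring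
    _ ≤ 4 / 3 * ((3 / 4) ^ α * d ^ α) := by
      have := Real.rpow_le_rpow_of_exponent_ge (by norm_num : (0 : ℝ) < 3 / 4) (by norm_num) h1
      gcongr
    _ = 4 / 3 * (3 / 4 * d) ^ α := by rw [Real.mul_rpow (by norm_num) hd.le]
    _ ≤ _ := by
      gcongr
      exact le_min (by linarith) (by linarith)

lemma setLIntegral_coneSet_le (f : Euc (n + 1) → ℝ≥0∞) :
    ∫⁻ p in coneSet n Z₀ Z₁, f ((splitCLE 0).symm p) ≤ ∫⁻ x in Omg (n + 1), f x := by
  rw [← (measurePreserving_splitCLE_symm 0).setLIntegral_comp_preimage_emb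
    (measurableEmbedding_splitCLE_symm 0)]
  exact lintegral_mono_set fun p hp => splitCLE_symm_mem_Omg 0 hp.2.1

lemma lintegral_coneSet_fderiv_le (h₀ : IsCantorMeasure β₀ A₀ ν₀ Z₀) {α P q : ℝ} (h0 : 0 ≤ α)
    (h1 : α ≤ 1) (hq : 0 ≤ q) (φ : Euc (n + 1) → ℝ) {l : ℝ} (hl : 0 < l) :
    ∫⁻ p in coneSet n Z₀ Z₁, ENNReal.ofReal (Metric.infDist p.1 Z₀ ^ α *
        (l * ‖fderiv ℝ (φ ∘ (splitCLE 0).symm) p‖) ^ q) ≤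
      ENNReal.ofReal (4 / 3) * ∫⁻ x in Omg (n + 1), ENNReal.ofReal
        ((l * (‖((splitCLE (0 : Fin (n + 1))).symm : (ℝ × (Fin n → ℝ)) →L[ℝ] Euc (n + 1))‖ + 1) *
            ‖gradient φ x - gradient (jumpEuc n ν₀ Z₁) x‖) ^ P +
          coneWeight n α Z₀ Z₁ x *
          (l * (‖((splitCLE (0 : Fin (n + 1))).symm : (ℝ × (Fin n → ℝ)) →L[ℝ] Euc (n + 1))‖ + 1) *
            ‖gradient φ x - gradient (jumpEuc n ν₀ Z₁) x‖) ^ q) := by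
  set e := ((splitCLE (0 : Fin (n + 1))).symm : (ℝ × (Fin n → ℝ)) →L[ℝ] Euc (n + 1)) with he
  refine le_trans ?_ (mul_le_mul_right (setLIntegral_coneSet_le (Z₀ := Z₀) (Z₁ := Z₁) _) _)
  rw [← lintegral_const_mul' _ _ ENNReal.ofReal_ne_top]
  refine lintegral_mono_ae ?_
  have hz : ∀ᵐ p : ℝ × (Fin n → ℝ), p.1 ∉ Z₀ :=
    Measure.quasiMeasurePreserving_fst.ae (measure_eq_zero_iff_ae_notMem.1 h₀.null)
  filter_upwards [ae_restrict_of_ae hz, ae_restrict_mem measurableSet_coneSet] with p hpz hp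
  have hd : 0 < Metric.infDist p.1 Z₀ :=
    (h₀.compact.isClosed.notMem_iff_infDist_pos h₀.nonempty).1 hpz
  have hd1 := h₀.infDist_le hp.1
  have hg : gradient (jumpEuc n ν₀ Z₁) ((splitCLE 0).symm p) = 0 := by
    refine gradient_jumpEuc_eq_zero h₀ ?_
    rw [splitCLE_symm_same, ContinuousLinearEquiv.apply_symm_apply]
    have := hp.2.2
    linarith
  have hfd : ‖fderiv ℝ (φ ∘ (splitCLE 0).symm) p‖ ≤
      (‖e‖ + 1) * ‖gradient φ ((splitCLE 0).symm p)‖ := by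
    rw [ContinuousLinearEquiv.comp_right_fderiv, norm_gradient]
    refine (ContinuousLinearMap.opNorm_comp_le _ _).trans ?_
    rw [mul_comm]
    gcongr
    linarith
  rw [hg, sub_zero, ← ENNReal.ofReal_mul (by norm_num)]
  refine ENNReal.ofReal_le_ofReal ?_
  have hw := mul_rpow_le_coneWeight h0 h1 hp hd (by linarith)
  have hw0 : 0 ≤ coneWeight n α Z₀ Z₁ ((splitCLE 0).symm p) := cutPow_nonneg _ _
  calc Metric.infDist p.1 Z₀ ^ α * (l * ‖fderiv ℝ (φ ∘ (splitCLE 0).symm) p‖) ^ q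
      ≤ (4 / 3 * coneWeight n α Z₀ Z₁ ((splitCLE 0).symm p)) *
        (l * (‖e‖ + 1) * ‖gradient φ ((splitCLE 0).symm p)‖) ^ q := by
        rw [mul_assoc l]
        gcongr
    _ ≤ _ := by
        rw [mul_assoc]
        have : 0 ≤ (l * (‖e‖ + 1) * ‖gradient φ ((splitCLE 0).symm p)‖) ^ P := by positivity
        gcongr
        linarith

lemma not_exists_approximation (h₀ : IsCantorMeasure β₀ A₀ ν₀ Z₀)
    (h₁ : IsCantorMeasure β₁ A₁ ν₁ Z₁) (hβ₁ : 0 ≤ β₁) {α P q : ℝ} (h0 : 0 ≤ α) (h1 : α ≤ 1)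
    (hq : 1 < q) (hs0 : 0 < α + n * β₁) (hs : α + n * β₁ < (q - 1) * β₀)
    {φ : ℕ → Euc (n + 1) → ℝ} (hφ : ∀ j, ContDiffOn ℝ (⊤ : ℕ∞) (φ j) (Omg (n + 1)))
    (hL : Tendsto (fun j => ∫⁻ x in Omg (n + 1), ENNReal.ofReal |φ j x - jumpEuc n ν₀ Z₁ x|)
      atTop (𝓝 0))
    (hE : ∀ lam : ℝ, 0 < lam → Tendsto (fun j => ∫⁻ x in Omg (n + 1), ENNReal.ofReal
        ((lam * ‖gradient (φ j) x - gradient (jumpEuc n ν₀ Z₁) x‖) ^ P +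
          coneWeight n α Z₀ Z₁ x *
            (lam * ‖gradient (φ j) x - gradient (jumpEuc n ν₀ Z₁) x‖) ^ q)) atTop (𝓝 0)) :
    False := by
  obtain ⟨c, C, M, hc, hC, hM, key⟩ := exists_le_lintegral_coneSet h₀ h₁ hβ₁ hq hs0 hs
  have hle : ∀ l : ℝ, 0 < l → c ≤ ENNReal.ofReal l⁻¹ * M := by
    intro l hl
    have hlim := hE (l * (‖((splitCLE (0 : Fin (n + 1))).symm :
      (ℝ × (Fin n → ℝ)) →L[ℝ] Euc (n + 1))‖ + 1)) (by positivity)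
    have hlim2 := ((ENNReal.Tendsto.const_mul hL (Or.inr hC)).add
      (ENNReal.Tendsto.const_mul ((ENNReal.Tendsto.const_mul (ENNReal.Tendsto.const_mul hlim
        (Or.inr (ENNReal.ofReal_ne_top (r := 4 / 3)))) (Or.inr hC)).add
          (tendsto_const_nhds (x := M))) (Or.inr (ENNReal.ofReal_ne_top (r := l⁻¹)))))
    simp only [mul_zero, zero_add] at hlim2
    refine ge_of_tendsto' hlim2 fun j => ?_
    have hsm : ContDiffOn ℝ 1 (φ j ∘ (splitCLE (0 : Fin (n + 1))).symm) (Metric.ball 0 1) := by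
      refine ((hφ j).of_le (by exact_mod_cast le_top)).comp
        (splitCLE (0 : Fin (n + 1))).symm.contDiff.contDiffOn fun p hp => ?_
      exact splitCLE_symm_mem_Omg 0 (by simpa using hp)
    refine (key _ hsm l hl).trans ?_
    gcongr
    · refine le_of_eq_of_le ?_ (setLIntegral_coneSet_le (Z₀ := Z₀) (Z₁ := Z₁) _)
      refine lintegral_congr fun p => ?_
      rw [jumpEuc, ContinuousLinearEquiv.apply_symm_apply]
      rfl
    · exact lintegral_coneSet_fderiv_le h₀ h0 h1 (by linarith) (φ j) hl
  have hlim : Tendsto (fun l : ℝ => ENNReal.ofReal l⁻¹ * M) atTop (𝓝 0) := by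
    have := ENNReal.Tendsto.mul_const (ENNReal.tendsto_ofReal tendsto_inv_atTop_zero)
      (Or.inr hM)
    simpa using this
  exact hc (le_zero_iff.1 (ge_of_tendsto hlim ((eventually_gt_atTop 0).mono hle)))

end

/-- Theorem A (0-form case), non-density `H ≠ W` for the double phase integrand
`Φ(x,t) = t^p + a(x) t^q`: the function `w` cannot be approximated by smooth
functions with convergence of the modular energy. -/
theorem statement1 (N : ℕ) (hN : 2 ≤ N) (p q α : ℝ) (hp : 1 < p)
    (hα : α ∈ Set.Icc (0 : ℝ) 1)
    (hq : p + α * max 1 ((p - 1) / ((N : ℝ) - 1)) < q) :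
    ∃ (a : Euc N → ℝ) (S : Set (Euc N)) (w : Euc N → ℝ) (g : Euc N → Euc N),
      -- the weight: nonnegative, bounded, Hölder of exponent α (Lipschitz if α = 1)
      (∀ x, 0 ≤ a x) ∧ (∃ M : ℝ, ∀ x, a x ≤ M) ∧
      (0 < α → ∃ L : ℝ, ∀ x y, |a x - a y| ≤ L * dist x y ^ α) ∧
      -- the singular set
      IsCompact S ∧ S ⊆ Omg N ∧ volume S = 0 ∧
      -- the function w with weak gradient g, of finite energy
      (∃ M : ℝ, ∀ x, |w x| ≤ M) ∧ ContDiffOn ℝ (⊤ : ℕ∞) w (Omg N \ S) ∧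
      HasWeakGradOn N w g ∧
      IntegrableOn (fun x => ‖g x‖ ^ p + a x * ‖g x‖ ^ q) (Omg N) ∧
      -- non-approximability by smooth functions with energy convergence
      ¬ ∃ φ : ℕ → Euc N → ℝ,
          (∀ j, ContDiffOn ℝ (⊤ : ℕ∞) (φ j) (Omg N)) ∧
          (∀ j, (∫⁻ x in Omg N,
              ENNReal.ofReal (‖gradient (φ j) x‖ ^ p + a x * ‖gradient (φ j) x‖ ^ q)) < ⊤) ∧
          Tendsto (fun j => ∫⁻ x in Omg N, ENNReal.ofReal |φ j x - w x|) atTop (𝓝 0) ∧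
          (∀ lam : ℝ, 0 < lam →
            Tendsto (fun j => ∫⁻ x in Omg N,
                ENNReal.ofReal ((lam * ‖gradient (φ j) x - g x‖) ^ p
                  + a x * (lam * ‖gradient (φ j) x - g x‖) ^ q))
              atTop (𝓝 0)) := by
  obtain ⟨hα0, hα1⟩ := hα
  obtain ⟨n, rfl⟩ : ∃ n, N = n + 1 := ⟨N - 1, by omega⟩
  have hn : 0 < n := by omega
  have hn' : (0 : ℝ) < n := Nat.cast_pos.2 hn
  rw [Nat.cast_add, Nat.cast_one, add_sub_cancel_right] at hq
  have hp' : 0 < p - 1 := by linarith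
  have hm0 : 0 ≤ α * max 1 ((p - 1) / n) := by positivity
  have hpq : 0 < q - p := by linarith
  have hα2 : α < q - p := by
    have := mul_le_mul_of_nonneg_left (le_max_left 1 ((p - 1) / n)) hα0
    linarith
  have hα3 : α * ((p - 1) / n) < q - p := by
    have := mul_le_mul_of_nonneg_left (le_max_right 1 ((p - 1) / n)) hα0
    linarith
  obtain ⟨β₀, hβ1, hβ2⟩ := exists_between (show α / (q - p) < min 1 (n / (p - 1)) by
    refine lt_min ((div_lt_one hpq).2 hα2) ?_
    rw [div_lt_div_iff₀ hpq hp']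
    rw [mul_div_assoc', div_lt_iff₀ hn'] at hα3
    linarith)
  obtain ⟨hβ₀1, hβ₀2⟩ := lt_min_iff.1 hβ2
  have hβ₀ : 0 < β₀ := lt_of_le_of_lt (by positivity) hβ1
  rw [div_lt_iff₀ hpq] at hβ1
  rw [lt_div_iff₀ hp'] at hβ₀2
  obtain ⟨β₁, hβ3, hβ4⟩ := exists_between
    (show (p - 1) * β₀ / n < min 1 (((q - 1) * β₀ - α) / n) by
      refine lt_min ((div_lt_one hn').2 (by linarith)) ?_
      gcongr
      nlinarith)
  obtain ⟨hβ₁1, hβ₁2⟩ := lt_min_iff.1 hβ4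
  have hβ₁ : 0 < β₁ := lt_of_le_of_lt (by positivity) hβ3
  rw [div_lt_iff₀ hn'] at hβ3
  rw [lt_div_iff₀ hn'] at hβ₁2
  obtain ⟨A₀, ν₀, Z₀, h₀⟩ := exists_isCantorMeasure hβ₀ hβ₀1
  obtain ⟨A₁, ν₁, Z₁, h₁⟩ := exists_isCantorMeasure hβ₁ hβ₁1
  have := h₀.prob
  have hScpt := isCompact_prodSet (n := n) h₀.compact h₁.compact
  have hgp := integrableOn_norm_gradient_rpow hn h₀ h₁ hp hβ₀ (by linarith)
  have hbdd : ∀ x, |jumpEuc n ν₀ Z₁ x| ≤ 1 := fun x => abs_jumpFun_le _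
  have hgrad : HasWeakGradOn (n + 1) (jumpEuc n ν₀ Z₁) (gradient (jumpEuc n ν₀ Z₁)) := by
    refine hasWeakGradOn_gradient hScpt.isClosed (volume_prodSet h₀.null) (fun i => ?_)
      (fun x hx => (contDiffAt_jumpEuc h₀ h₁ hx).differentiableAt (by simp)) hbdd
      (integrableOn_of_integrableOn_norm_rpow (measurable_gradient _) hp hgp)
    by_cases hi : i = 0
    · subst hi
      exact ⟨⟨0, hn⟩, Z₁, h₁.null, fun x hx => hx.2 ⟨0, hn⟩⟩
    · obtain ⟨j, hj⟩ := Fin.exists_succAbove_eq (Ne.symm hi)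
      exact ⟨j, Z₀, h₀.null, fun x hx => by rw [hj]; exact hx.1⟩
  refine ⟨coneWeight n α Z₀ Z₁, prodSet n Z₀ Z₁, jumpEuc n ν₀ Z₁, gradient (jumpEuc n ν₀ Z₁),
    fun x => cutPow_nonneg _ _, ⟨1, fun x => cutPow_le_one hα0 _⟩,
    fun h => ⟨3 ^ α, abs_coneWeight_sub_le h hα1⟩, hScpt, prodSet_subset_Omg h₀.subset h₁.subset,
    volume_prodSet h₀.null, ⟨1, hbdd⟩,
    fun x hx => (contDiffAt_jumpEuc h₀ h₁ hx.2).contDiffWithinAt, hgrad, ?_, ?_⟩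
  · simpa only [coneWeight_mul_norm_gradient_rpow h₀ (show q ≠ 0 by linarith), add_zero] using hgp
  · rintro ⟨φ, hφ, -, hL, hE⟩
    refine not_exists_approximation h₀ h₁ hβ₁.le hα0 hα1 (by linarith) (by positivity)
      (by linarith) hφ hL hE

end
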